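/- arXiv:1511.01252 — 3 statements merged into one kernel-verified Lean document; each statement's English description precedes it below -/
import Mathlib

section
/- (Korn inequality with a Dirichlet condition at a rough bottom.) Let 1 < p < ∞. There exists a constant C > 0, depending only on p, such that the following holds. Let γ : ℝ → ℝ be continuous, 1-periodic, with values in (−1, 0), let Ω_bl = {(y₁, y₂) ∈ ℝ² : 0 < y₁ < 1, y₂ > γ(y₁)}, and let u : ℝ² → ℝ² be Lipschitz, 1-periodic in its first variable, vanishing at every point (y₁, y₂) with y₂ ≤ γ(y₁), and satisfying ∫_{Ω_bl} ‖∇u‖_F^p dy < ∞. Then ∫_{Ω_bl} ‖∇u(y)‖_F^p dy ≤ C ∫_{Ω_bl} ‖Du(y)‖_F^p dy. -/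
open MeasureTheory Matrix

/-- The Jacobian matrix of a map `u : ℝ² → ℝ²`: entry `(i, j)` is `∂uᵢ/∂yⱼ`
(defined via `fderiv`, which equals the true differential almost everywhere for
Lipschitz maps by Rademacher's theorem). -/
noncomputable def jacMat (u : ℝ × ℝ → ℝ × ℝ) (y : ℝ × ℝ) : Matrix (Fin 2) (Fin 2) ℝ :=
  !![(fderiv ℝ u y (1, 0)).1, (fderiv ℝ u y (0, 1)).1;
     (fderiv ℝ u y (1, 0)).2, (fderiv ℝ u y (0, 1)).2]

/-- The symmetric part `(A + Aᵀ)/2` of a 2×2 matrix. -/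
noncomputable def symPart (A : Matrix (Fin 2) (Fin 2) ℝ) : Matrix (Fin 2) (Fin 2) ℝ :=
  (1 / 2 : ℝ) • (A + Aᵀ)

/-- The Frobenius norm of a 2×2 matrix. -/
noncomputable def frobNorm (A : Matrix (Fin 2) (Fin 2) ℝ) : ℝ :=
  Real.sqrt (∑ i, ∑ j, (A i j) ^ 2)

theorem exists_rpow_taylor_bound (s M : ℝ) {d : ℝ} (hd : 0 < d) :
    ∃ C, 0 ≤ C ∧ ∀ t ∈ Set.Icc d M, ∀ t' ∈ Set.Icc d M,
      |t' ^ s - t ^ s - s * t ^ (s - 1) * (t' - t)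
        - s * (s - 1) / 2 * t ^ (s - 2) * (t' - t) ^ 2| ≤ C * |t' - t| ^ 3 := by
  have hcont : ContinuousOn (fun x : ℝ => x ^ (s - 3)) (Set.Icc d M) := fun x hx =>
    (Real.continuousAt_rpow_const x _ (Or.inl (hd.trans_le hx.1).ne')).continuousWithinAt
  obtain ⟨B, hB⟩ := isCompact_Icc.exists_bound_of_continuousOn hcont
  refine ⟨|s * (s - 1) * (s - 2)| * |B| / 6, by positivity, fun t ht t' ht' => ?_⟩
  rcases eq_or_ne t t' with rfl | hne
  · simp
  have hsub : Set.uIcc t t' ⊆ Set.Icc d M := Set.uIcc_subset_Icc ht ht'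
  have hcd : ∀ x ∈ Set.uIcc t t', ContDiffAt ℝ 3 (fun x : ℝ => x ^ s) x := fun x hx =>
    Real.contDiffAt_rpow_const_of_ne (hd.trans_le (hsub hx).1).ne'
  obtain ⟨y, hy, hy'⟩ := taylor_mean_remainder_lagrange_iteratedDeriv (n := 2) hne
    (fun x hx => by exact_mod_cast (hcd x hx).contDiffWithinAt)
  have hud : UniqueDiffOn ℝ (Set.uIcc t t') := uniqueDiffOn_uIcc hne
  have htm : t ∈ Set.uIcc t t' := Set.left_mem_uIcc
  have hD : ∀ k : ℕ, k ≤ 3 → iteratedDerivWithin k (fun x : ℝ => x ^ s) (Set.uIcc t t') t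
      = (descPochhammer ℝ k).eval s * t ^ (s - k) := by
    intro k hk
    rw [iteratedDerivWithin_eq_iteratedDeriv hud ((hcd t htm).of_le (by exact_mod_cast hk)) htm,
      iteratedDeriv_eq_iterate, Real.iter_deriv_rpow_const]
  have h1 := hD 1 (by norm_num)
  have h2 := hD 2 (by norm_num)
  have hyD : y ∈ Set.Icc d M := hsub (Set.Ioo_subset_Icc_self hy)
  rw [iteratedDeriv_eq_iterate, Real.iter_deriv_rpow_const, taylorWithinEval_succ,
    taylorWithinEval_succ, taylor_within_zero_eval] at hy'
  simp only [zero_add] at hy'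
  rw [h1, h2] at hy'
  have hp2 : (descPochhammer ℝ 2).eval s = s * (s - 1) := by
    rw [descPochhammer_succ_eval]; simp
  have hp3 : (descPochhammer ℝ 3).eval s = s * (s - 1) * (s - 2) := by
    rw [descPochhammer_succ_eval, hp2]; simp
  rw [show (2 + 1 : ℕ) = 3 from rfl, hp3] at hy'
  rw [show (1 + 1 : ℕ) = 2 from rfl, hp2] at hy'
  have hfin : t' ^ s - t ^ s - s * t ^ (s - 1) * (t' - t)
        - s * (s - 1) / 2 * t ^ (s - 2) * (t' - t) ^ 2
      = s * (s - 1) * (s - 2) * y ^ (s - 3) * (t' - t) ^ 3 / 6 := by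
    norm_num [Nat.factorial] at hy'
    linarith
  rw [hfin, abs_div, abs_mul, abs_mul, abs_pow]
  have := (hB y hyD).trans (le_abs_self B)
  rw [Real.norm_eq_abs] at this
  rw [abs_of_pos (by norm_num : (0:ℝ) < 6)]
  have : |s * (s - 1) * (s - 2)| * |y ^ (s - 3)| * |t' - t| ^ 3
    ≤ |s * (s - 1) * (s - 2)| * |B| * |t' - t| ^ 3 := by gcongr
  linarith

theorem exists_rpow_quadratic_bound {s d : ℝ} (M : ℝ) (hs : 1 / 2 < s) (hd : 0 < d) :
    ∃ C, 0 ≤ C ∧ ∀ t ∈ Set.Icc d M, ∀ t' ∈ Set.Icc d M, ∀ β w : ℝ, 0 ≤ w →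
      t' = t + 2 * β + w ^ 2 → β ^ 2 ≤ t * w ^ 2 →
      t ^ s + 2 * s * t ^ (s - 1) * β + s * min 1 (2 * s - 1) * t ^ (s - 1) * w ^ 2 - C * w ^ 3
          ≤ t' ^ s ∧
      t' ^ s ≤ t ^ s + 2 * s * t ^ (s - 1) * β + s * max 1 (2 * s - 1) * t ^ (s - 1) * w ^ 2
          + C * w ^ 3 := by
  obtain ⟨C₀, hC₀, hT⟩ := exists_rpow_taylor_bound s M hd
  have hcont : ContinuousOn (fun x : ℝ => x ^ (s - 2)) (Set.Icc d M) := fun x hx =>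
    (Real.continuousAt_rpow_const x _ (Or.inl (hd.trans_le hx.1).ne')).continuousWithinAt
  obtain ⟨B, hB⟩ := isCompact_Icc.exists_bound_of_continuousOn hcont
  set m := √M with hm
  have hm0 : 0 ≤ m := Real.sqrt_nonneg _
  refine ⟨|s * (s - 1) / 2| * |B| * (6 * m) + C₀ * (4 * m) ^ 3, by positivity, ?_⟩
  intro t ht t' ht' β w hw htt hβ
  have ht0 : 0 < t := hd.trans_le ht.1
  have hst : √t ≤ m := Real.sqrt_le_sqrt ht.2
  have hst' : √t' ≤ m := Real.sqrt_le_sqrt ht'.2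
  have hsq : √t ^ 2 = t := Real.sq_sqrt ht0.le
  have hβ' : |β| ≤ √t * w := by
    apply abs_le_of_sq_le_sq _ (by positivity)
    rw [mul_pow, hsq]; exact hβ
  have hβm : |β| ≤ m * w := hβ'.trans (by gcongr)
  have hwm : w ≤ 2 * m := by
    have h1 : (w - √t) ^ 2 ≤ t' := by
      rw [htt]; nlinarith [neg_abs_le β]
    have h2 := Real.abs_le_sqrt h1
    linarith [le_abs_self (w - √t)]
  have hΔ : t' - t = 2 * β + w ^ 2 := by rw [htt]; ring
  have hΔ' : |t' - t| ≤ 4 * m * w := by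
    rw [hΔ]
    have : |2 * β + w ^ 2| ≤ 2 * |β| + w ^ 2 := by
      refine (abs_add_le _ _).trans ?_
      rw [abs_mul, abs_of_pos (by norm_num : (0:ℝ) < 2), abs_of_nonneg (sq_nonneg w)]
    nlinarith
  have hE := hT t ht t' ht'
  have hE' : C₀ * |t' - t| ^ 3 ≤ C₀ * (4 * m) ^ 3 * w ^ 3 := by
    rw [mul_assoc, ← mul_pow]; gcongr
  have hr : |4 * β * w ^ 2 + w ^ 4| ≤ 6 * m * w ^ 3 := by
    have : |4 * β * w ^ 2 + w ^ 4| ≤ 4 * |β| * w ^ 2 + w ^ 4 := by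
      refine (abs_add_le _ _).trans ?_
      rw [abs_mul, abs_mul, abs_of_pos (by norm_num : (0:ℝ) < 4), abs_of_nonneg (sq_nonneg w),
        abs_of_nonneg (by positivity : 0 ≤ w ^ 4)]
    have h2 : |β| * w ^ 2 ≤ m * w * w ^ 2 := by gcongr
    have h3 : w * w ^ 3 ≤ 2 * m * w ^ 3 := by gcongr
    nlinarith
  have hBt : |t ^ (s - 2)| ≤ |B| := (hB t ht).trans (le_abs_self B)
  have hmid : |s * (s - 1) / 2 * t ^ (s - 2) * (4 * β * w ^ 2 + w ^ 4)|
      ≤ |s * (s - 1) / 2| * |B| * (6 * m) * w ^ 3 := by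
    rw [abs_mul, abs_mul, mul_assoc (|s * (s - 1) / 2| * |B|)]
    gcongr
  set θ := β ^ 2 / t with hθ
  have hθ0 : 0 ≤ θ := by positivity
  have hθ1 : θ ≤ w ^ 2 := by rw [hθ, div_le_iff₀ ht0]; linarith
  have hβθ : t ^ (s - 2) * β ^ 2 = t ^ (s - 1) * θ := by
    have : t ^ (s - 1) = t ^ (s - 2) * t := by
      rw [← Real.rpow_add_one ht0.ne']; ring_nf
    rw [this, hθ]; field_simp
  have hP : 0 < s * t ^ (s - 1) := by have := Real.rpow_pos_of_pos ht0 (s - 1); positivity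
  have hlow : min 1 (2 * s - 1) * w ^ 2 ≤ w ^ 2 + 2 * (s - 1) * θ := by
    rcases le_total 1 s with h | h
    · rw [min_eq_left (by linarith)]; nlinarith
    · rw [min_eq_right (by linarith)]; nlinarith
  have hup : w ^ 2 + 2 * (s - 1) * θ ≤ max 1 (2 * s - 1) * w ^ 2 := by
    rcases le_total 1 s with h | h
    · rw [max_eq_right (by linarith)]; nlinarith
    · rw [max_eq_left (by linarith)]; nlinarith
  have key : t' ^ s - t ^ s - s * t ^ (s - 1) * (t' - t)
        - s * (s - 1) / 2 * t ^ (s - 2) * (t' - t) ^ 2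
      = t' ^ s - t ^ s - 2 * s * t ^ (s - 1) * β
        - s * t ^ (s - 1) * (w ^ 2 + 2 * (s - 1) * θ)
        - s * (s - 1) / 2 * t ^ (s - 2) * (4 * β * w ^ 2 + w ^ 4) := by
    rw [hΔ]
    linear_combination (-2 * s * (s - 1)) * hβθ
  rw [key] at hE
  have h1 := mul_le_mul_of_nonneg_left hlow hP.le
  have h2 := mul_le_mul_of_nonneg_left hup hP.le
  have hE1 := abs_le.1 (hE.trans hE')
  have hmid1 := abs_le.1 hmid
  constructor <;> linarith

section Density

variable {H H' : Type*} [NormedAddCommGroup H] [InnerProductSpace ℝ H]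
  [NormedAddCommGroup H'] [InnerProductSpace ℝ H']

/-- The regularised integrand `(|a|² + μ |S a|² + d)^s - 2 (|a|² + d)^s`. -/
noncomputable def kornDensity (S : H →L[ℝ] H') (μ s d : ℝ) (a : H) : ℝ :=
  (‖a‖ ^ 2 + μ * ‖S a‖ ^ 2 + d) ^ s - 2 * (‖a‖ ^ 2 + d) ^ s

theorem exists_weighted_rpow_quadratic_bound {s d μ : ℝ} (B : ℝ) (hs : 1 / 2 < s) (hd : 0 < d)
    (hμ : 0 ≤ μ) (S : H →L[ℝ] H') (hS : ∀ x, ‖S x‖ ≤ ‖x‖) :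
    ∃ C, 0 ≤ C ∧ ∀ a v : H, ‖a‖ ≤ B → ‖a + v‖ ≤ B →
      (‖a‖ ^ 2 + μ * ‖S a‖ ^ 2 + d) ^ s
          + 2 * s * (‖a‖ ^ 2 + μ * ‖S a‖ ^ 2 + d) ^ (s - 1)
            * (inner ℝ a v + μ * inner ℝ (S a) (S v))
          + s * min 1 (2 * s - 1) * (‖a‖ ^ 2 + μ * ‖S a‖ ^ 2 + d) ^ (s - 1)
            * (‖v‖ ^ 2 + μ * ‖S v‖ ^ 2) - C * ‖v‖ ^ 3
          ≤ (‖a + v‖ ^ 2 + μ * ‖S (a + v)‖ ^ 2 + d) ^ s ∧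
      (‖a + v‖ ^ 2 + μ * ‖S (a + v)‖ ^ 2 + d) ^ s
        ≤ (‖a‖ ^ 2 + μ * ‖S a‖ ^ 2 + d) ^ s
          + 2 * s * (‖a‖ ^ 2 + μ * ‖S a‖ ^ 2 + d) ^ (s - 1)
            * (inner ℝ a v + μ * inner ℝ (S a) (S v))
          + s * max 1 (2 * s - 1) * (‖a‖ ^ 2 + μ * ‖S a‖ ^ 2 + d) ^ (s - 1)
            * (‖v‖ ^ 2 + μ * ‖S v‖ ^ 2) + C * ‖v‖ ^ 3 := by
  obtain ⟨C, hC, h⟩ := exists_rpow_quadratic_bound ((1 + μ) * B ^ 2 + d) hs hd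
  refine ⟨C * √(1 + μ) ^ 3, by positivity, fun a v ha hav => ?_⟩
  have hmem : ∀ x : H, ‖x‖ ≤ B → ‖x‖ ^ 2 + μ * ‖S x‖ ^ 2 + d ∈ Set.Icc d ((1 + μ) * B ^ 2 + d) := by
    intro x hx
    have h1 : ‖S x‖ ^ 2 ≤ B ^ 2 := by gcongr; exact (hS x).trans hx
    have h2 : ‖x‖ ^ 2 ≤ B ^ 2 := by gcongr
    constructor
    · have : 0 ≤ ‖x‖ ^ 2 + μ * ‖S x‖ ^ 2 := by positivity
      linarith
    · nlinarith
  have hq0 : 0 ≤ ‖v‖ ^ 2 + μ * ‖S v‖ ^ 2 := by positivity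
  have hw : √(‖v‖ ^ 2 + μ * ‖S v‖ ^ 2) ≤ √(1 + μ) * ‖v‖ := by
    rw [← Real.sqrt_sq (norm_nonneg v), ← Real.sqrt_mul (by positivity), Real.sqrt_sq (norm_nonneg v)]
    apply Real.sqrt_le_sqrt
    have : ‖S v‖ ^ 2 ≤ ‖v‖ ^ 2 := by gcongr; exact hS v
    nlinarith
  have hcub : C * √(‖v‖ ^ 2 + μ * ‖S v‖ ^ 2) ^ 3 ≤ C * √(1 + μ) ^ 3 * ‖v‖ ^ 3 := by
    rw [mul_assoc, ← mul_pow]; gcongr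
  have hexp : ‖a + v‖ ^ 2 + μ * ‖S (a + v)‖ ^ 2 + d = ‖a‖ ^ 2 + μ * ‖S a‖ ^ 2 + d
      + 2 * (inner ℝ a v + μ * inner ℝ (S a) (S v)) + √(‖v‖ ^ 2 + μ * ‖S v‖ ^ 2) ^ 2 := by
    rw [Real.sq_sqrt hq0, map_add, norm_add_sq_real, norm_add_sq_real]; ring
  have hcs : (inner ℝ a v + μ * inner ℝ (S a) (S v)) ^ 2
      ≤ (‖a‖ ^ 2 + μ * ‖S a‖ ^ 2 + d) * √(‖v‖ ^ 2 + μ * ‖S v‖ ^ 2) ^ 2 := by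
    rw [Real.sq_sqrt hq0]
    have h1 : |inner ℝ a v + μ * inner ℝ (S a) (S v)| ≤ ‖a‖ * ‖v‖ + μ * (‖S a‖ * ‖S v‖) := by
      refine (abs_add_le _ _).trans ?_
      rw [abs_mul, abs_of_nonneg hμ]
      have h2 := abs_real_inner_le_norm a v
      have h3 := abs_real_inner_le_norm (S a) (S v)
      gcongr
    have h2 := pow_le_pow_left₀ (abs_nonneg _) h1 2
    rw [sq_abs] at h2
    have h3 : 0 ≤ μ * (‖a‖ * ‖S v‖ - ‖S a‖ * ‖v‖) ^ 2 := by positivity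
    have h4 : 0 ≤ d * (‖v‖ ^ 2 + μ * ‖S v‖ ^ 2) := by positivity
    nlinarith
  obtain ⟨h1, h2⟩ := h _ (hmem a ha) _ (hmem _ hav) _ _ (Real.sqrt_nonneg _) hexp hcs
  rw [Real.sq_sqrt hq0] at h1 h2
  constructor <;> linarith

theorem exists_large_weight {s : ℝ} (hs : 0 < s) (T : ℝ) :
    ∃ μ : ℝ, 0 ≤ μ ∧ T ≤ μ * min 1 ((1 + μ) ^ (s - 1)) := by
  set T' := max 1 (2 * T) with hT'
  have hT1 : 1 ≤ T' := le_max_left _ _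
  set N := max (max 2 T') (T' ^ s⁻¹) with hN
  have hN2 : 2 ≤ N := (le_max_left _ _).trans (le_max_left _ _)
  have hNT : T' ≤ N := (le_max_right _ _).trans (le_max_left _ _)
  have hNs : T' ≤ N ^ s := by
    calc T' = (T' ^ s⁻¹) ^ s := by rw [← Real.rpow_mul (by positivity), inv_mul_cancel₀ hs.ne',
              Real.rpow_one]
      _ ≤ N ^ s := by gcongr; exact le_max_right _ _
  refine ⟨N - 1, by linarith, ?_⟩
  have hN0 : 0 < N := by linarith
  have hpow : N * N ^ (s - 1) = N ^ s := by
    rw [mul_comm, ← Real.rpow_add_one hN0.ne']; ring_nf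
  have h2T : 2 * T ≤ T' := le_max_right _ _
  rw [show 1 + (N - 1) = N by ring]
  have hp := Real.rpow_pos_of_pos hN0 (s - 1)
  rcases min_cases 1 (N ^ (s - 1)) with ⟨h, _⟩ | ⟨h, _⟩ <;> rw [h]
  · linarith
  · nlinarith

/-- The regularised integrand is, up to a cubic error, bounded below by its affine approximation
plus a nonnegative multiple of the quadratic form `K |S v|² - |v|²`. -/
theorem exists_kornDensity_lower_bound {s : ℝ} (hs : 1 / 2 < s) (K : ℝ) :
    ∃ μ : ℝ, 0 ≤ μ ∧ ∀ S : H →L[ℝ] H', (∀ x, ‖S x‖ ≤ ‖x‖) → ∀ d : ℝ, 0 < d → ∀ B : ℝ,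
      ∃ C, 0 ≤ C ∧ ∀ a : H, ‖a‖ ≤ B → ∃ (G : H →ₗ[ℝ] ℝ) (P : ℝ), 0 ≤ P ∧ P ≤ C ∧
        ∀ v : H, ‖a + v‖ ≤ B →
          kornDensity S μ s d a + G v + P * (K * ‖S v‖ ^ 2 - ‖v‖ ^ 2) - C * ‖v‖ ^ 3
            ≤ kornDensity S μ s d (a + v) := by
  set m := min 1 (2 * s - 1) with hm
  set N := max 1 (2 * s - 1) with hN
  have hm0 : 0 < m := lt_min one_pos (by linarith)
  have hN0 : 0 < N := lt_max_of_lt_left one_pos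
  obtain ⟨μ, hμ, hμT⟩ := exists_large_weight (by linarith : 0 < s) (2 * N * K / m)
  refine ⟨μ, hμ, fun S hS d hd B => ?_⟩
  obtain ⟨C₁, hC₁, h₁⟩ := exists_weighted_rpow_quadratic_bound B hs hd hμ S hS
  obtain ⟨C₂, hC₂, h₂⟩ := exists_weighted_rpow_quadratic_bound B hs hd le_rfl S hS
  simp only [zero_mul, add_zero] at h₂
  have hcont : ContinuousOn (fun x : ℝ => x ^ (s - 1)) (Set.Icc d (B ^ 2 + d)) := fun x hx =>
    (Real.continuousAt_rpow_const x _ (Or.inl (hd.trans_le hx.1).ne')).continuousWithinAt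
  obtain ⟨D, hD⟩ := isCompact_Icc.exists_bound_of_continuousOn hcont
  refine ⟨C₁ + 2 * C₂ + 2 * s * N * |D|, by positivity, fun a ha => ?_⟩
  set t := ‖a‖ ^ 2 + μ * ‖S a‖ ^ 2 + d with ht
  set r := ‖a‖ ^ 2 + d with hr
  have hr0 : 0 < r := by positivity
  have hrt : r ≤ t := by
    have : 0 ≤ μ * ‖S a‖ ^ 2 := by positivity
    rw [hr, ht]; linarith
  have ht0 : 0 < t := hr0.trans_le hrt
  have htr : t ≤ (1 + μ) * r := by
    have : ‖S a‖ ^ 2 ≤ ‖a‖ ^ 2 := by gcongr; exact hS a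
    rw [hr, ht]; nlinarith
  have hκ : min 1 ((1 + μ) ^ (s - 1)) * r ^ (s - 1) ≤ t ^ (s - 1) := by
    have hp := Real.rpow_pos_of_pos hr0 (s - 1)
    rcases le_total 1 s with h | h
    · calc _ ≤ 1 * r ^ (s - 1) := by gcongr; exact min_le_left _ _
        _ ≤ _ := by rw [one_mul]; exact Real.rpow_le_rpow hr0.le hrt (by linarith)
    · calc _ ≤ (1 + μ) ^ (s - 1) * r ^ (s - 1) := by gcongr; exact min_le_right _ _
        _ = ((1 + μ) * r) ^ (s - 1) := by rw [Real.mul_rpow (by positivity) hr0.le]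
        _ ≤ _ := Real.rpow_le_rpow_of_nonpos ht0 htr (by linarith)
  have hPD : r ^ (s - 1) ≤ |D| := by
    refine ((le_abs_self _).trans (hD r ⟨?_, ?_⟩)).trans (le_abs_self D)
    · rw [hr]; nlinarith [sq_nonneg ‖a‖]
    · rw [hr]; gcongr
  have hp := Real.rpow_pos_of_pos hr0 (s - 1)
  have hpt := Real.rpow_pos_of_pos ht0 (s - 1)
  refine ⟨(2 * s * t ^ (s - 1)) • ((innerSL ℝ a : H →L[ℝ] ℝ).toLinearMap
      + μ • (((innerSL ℝ (S a)) ∘L S : H →L[ℝ] ℝ)).toLinearMap)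
      - (2 * (2 * s * r ^ (s - 1))) • (innerSL ℝ a : H →L[ℝ] ℝ).toLinearMap,
    2 * s * N * r ^ (s - 1), by positivity, ?_, fun v hv => ?_⟩
  · have : 2 * s * N * r ^ (s - 1) ≤ 2 * s * N * |D| := by gcongr
    linarith
  have e₁ := (h₁ a v ha hv).1
  have e₂ := (h₂ a v ha hv).2
  simp only [LinearMap.sub_apply, LinearMap.smul_apply, LinearMap.add_apply,
    ContinuousLinearMap.coe_coe, innerSL_apply_apply, ContinuousLinearMap.comp_apply, smul_eq_mul]
  have hK' : 2 * s * N * r ^ (s - 1) * (K * ‖S v‖ ^ 2)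
      ≤ s * m * t ^ (s - 1) * (‖v‖ ^ 2 + μ * ‖S v‖ ^ 2) := by
    have h3 : 2 * N * K ≤ m * (μ * min 1 ((1 + μ) ^ (s - 1))) := by
      rw [div_le_iff₀ hm0] at hμT; linarith
    calc 2 * s * N * r ^ (s - 1) * (K * ‖S v‖ ^ 2)
        = s * (2 * N * K) * r ^ (s - 1) * ‖S v‖ ^ 2 := by ring
      _ ≤ s * (m * (μ * min 1 ((1 + μ) ^ (s - 1)))) * r ^ (s - 1) * ‖S v‖ ^ 2 := by gcongr
      _ = s * m * (min 1 ((1 + μ) ^ (s - 1)) * r ^ (s - 1)) * (μ * ‖S v‖ ^ 2) := by ring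
      _ ≤ s * m * t ^ (s - 1) * (μ * ‖S v‖ ^ 2) := by gcongr
      _ ≤ _ := by gcongr; nlinarith [sq_nonneg ‖v‖]
  have hcub : 0 ≤ 2 * s * N * |D| * ‖v‖ ^ 3 := by positivity
  unfold kornDensity
  linarith

end Density

theorem HasCompactSupport.comp_add_right {E F : Type*} [NormedAddCommGroup E] [Zero F] {f : E → F}
    (hf : HasCompactSupport f) (a : E) :
    HasCompactSupport fun x => f (x + a) :=
  hf.comp_homeomorph (Homeomorph.addRight a)

theorem integrable_norm_sq {E F : Type*} [NormedAddCommGroup E] [MeasurableSpace E]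
    [BorelSpace E] [NormedAddCommGroup F] (ν : Measure E) [IsFiniteMeasureOnCompacts ν]
    {f : E → F} (hf : Continuous f) (hc : HasCompactSupport f) :
    Integrable (fun x => ‖f x‖ ^ 2) ν :=
  Continuous.integrable_of_hasCompactSupport (by fun_prop)
    (hc.comp_left (g := fun y : F => ‖y‖ ^ 2) (by simp))

section Average

variable {E F G : Type*} [NormedAddCommGroup E] [NormedAddCommGroup F] [NormedSpace ℝ F]
  [NormedAddCommGroup G] [NormedSpace ℝ G]

/-- The average of a function over the three points `x`, `x + a`, `x + b`. -/
noncomputable def avg3 (a b : E) : (E → F) →ₗ[ℝ] (E → F) where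
  toFun f x := (1 / 3 : ℝ) • (f x + f (x + a) + f (x + b))
  map_add' f g := by ext x; simp only [Pi.add_apply]; module
  map_smul' c f := by ext x; simp only [Pi.smul_apply, RingHom.id_apply]; module

theorem avg3_apply (a b : E) (f : E → F) (x : E) :
    avg3 a b f x = (1 / 3 : ℝ) • (f x + f (x + a) + f (x + b)) := rfl

theorem avg3_pow_succ (a b : E) (f : E → F) (n : ℕ) :
    (avg3 a b ^ (n + 1)) f = avg3 a b ((avg3 a b ^ n) f) := by
  rw [pow_succ', Module.End.mul_apply]

theorem avg3_pow_induction (a b : E) {p : (E → F) → Prop} (h : ∀ f, p f → p (avg3 a b f))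
    {f : E → F} (hf : p f) (n : ℕ) : p ((avg3 a b ^ n) f) := by
  induction n with
  | zero => simpa using hf
  | succ n ih => rw [avg3_pow_succ]; exact h _ ih

theorem continuous_avg3 (a b : E) {f : E → F} (hf : Continuous f) : Continuous (avg3 a b f) := by
  have : Continuous fun x => (1 / 3 : ℝ) • (f x + f (x + a) + f (x + b)) := by fun_prop
  exact this

theorem hasCompactSupport_avg3 (a b : E) {f : E → F} (hf : HasCompactSupport f) :
    HasCompactSupport (avg3 a b f) := by
  have h := (hf.add (hf.comp_add_right a)).add (hf.comp_add_right b)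
  exact h.comp_left (g := fun y : F => (1 / 3 : ℝ) • y) (smul_zero _)

theorem continuous_avg3_pow (a b : E) {f : E → F} (hf : Continuous f) (n : ℕ) :
    Continuous ((avg3 a b ^ n) f) :=
  avg3_pow_induction a b (p := Continuous) (fun _ => continuous_avg3 a b) hf n

theorem hasCompactSupport_avg3_pow (a b : E) {f : E → F} (hf : HasCompactSupport f) (n : ℕ) :
    HasCompactSupport ((avg3 a b ^ n) f) :=
  avg3_pow_induction a b (p := HasCompactSupport) (fun _ => hasCompactSupport_avg3 a b) hf n

theorem avg3_pow_comp_clm (a b : E) (T : F →L[ℝ] G) (f : E → F) (n : ℕ) :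
    (avg3 a b ^ n) (fun x => T (f x)) = fun x => T ((avg3 a b ^ n) f x) := by
  induction n with
  | zero => rfl
  | succ n ih =>
    rw [avg3_pow_succ, avg3_pow_succ, ih]
    ext x
    simp only [avg3_apply, map_smul, map_add]

theorem avg3_pow_translate (a b c : E) (f : E → F) (n : ℕ) :
    (avg3 a b ^ n) (fun x => f (x + c)) = fun x => (avg3 a b ^ n) f (x + c) := by
  induction n with
  | zero => rfl
  | succ n ih =>
    rw [avg3_pow_succ, avg3_pow_succ, ih]
    ext x
    simp only [avg3_apply, add_right_comm]

theorem avg3_pow_norm_le (a b : E) {f : E → F} {B : ℝ} (hf : ∀ x, ‖f x‖ ≤ B) (n : ℕ) (x : E) :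
    ‖(avg3 a b ^ n) f x‖ ≤ B := by
  refine avg3_pow_induction a b (p := fun f => ∀ x, ‖f x‖ ≤ B) (fun f hf x => ?_) hf n x
  have h1 := norm_add_le (f x + f (x + a)) (f (x + b))
  have h2 := norm_add_le (f x) (f (x + a))
  rw [avg3_apply, norm_smul, Real.norm_of_nonneg (by norm_num)]
  linarith [hf x, hf (x + a), hf (x + b)]

/-- A finite-difference expansion of `f` is inherited by its averages. -/
theorem avg3_pow_expansion (a b c : E) {f ρ : E → F} {g : E → G} (T : G →L[ℝ] F)
    (h : ∀ x, f (x + c) - f x = T (g x) + ρ x) (n : ℕ) (x : E) :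
    (avg3 a b ^ n) f (x + c) - (avg3 a b ^ n) f x
      = T ((avg3 a b ^ n) g x) + (avg3 a b ^ n) ρ x := by
  have h' : (fun x => f (x + c)) - f = (fun x => T (g x)) + ρ := funext h
  have h2 := congrArg (fun φ => (avg3 a b ^ n) φ x) h'
  simpa only [map_sub, map_add, avg3_pow_translate, avg3_pow_comp_clm, Pi.sub_apply,
    Pi.add_apply] using h2

end Average

section Variance

variable {E F : Type*} [NormedAddCommGroup E] [NormedAddCommGroup F] [InnerProductSpace ℝ F]

/-- The sum of the squared deviations of `f` from its average over `x`, `x + a`, `x + b`. -/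
noncomputable def var3 (a b : E) (f : E → F) (x : E) : ℝ :=
  ‖f x - avg3 a b f x‖ ^ 2 + ‖f (x + a) - avg3 a b f x‖ ^ 2 + ‖f (x + b) - avg3 a b f x‖ ^ 2

theorem var3_add_norm_sq (a b : E) (f : E → F) (x : E) :
    var3 a b f x + 3 * ‖avg3 a b f x‖ ^ 2 = ‖f x‖ ^ 2 + ‖f (x + a)‖ ^ 2 + ‖f (x + b)‖ ^ 2 := by
  have h : inner ℝ (f x) (avg3 a b f x) + inner ℝ (f (x + a)) (avg3 a b f x)
      + inner ℝ (f (x + b)) (avg3 a b f x) = 3 * ‖avg3 a b f x‖ ^ 2 := by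
    rw [← inner_add_left, ← inner_add_left, ← real_inner_self_eq_norm_sq, ← real_inner_smul_left]
    congr 1
    rw [avg3_apply, smul_smul]; norm_num
  rw [var3, norm_sub_sq_real, norm_sub_sq_real, norm_sub_sq_real]
  linarith

theorem var3_nonneg (a b : E) (f : E → F) (x : E) : 0 ≤ var3 a b f x := by
  unfold var3; positivity

theorem norm_sq_sub_le (v w : F) : ‖v - w‖ ^ 2 ≤ 2 * ‖v‖ ^ 2 + 2 * ‖w‖ ^ 2 := by
  have := parallelogram_law_with_norm ℝ v w
  nlinarith [sq_nonneg ‖v + w‖]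

theorem norm_sq_add_le (v w : F) : ‖v + w‖ ^ 2 ≤ 2 * ‖v‖ ^ 2 + 2 * ‖w‖ ^ 2 := by
  have := parallelogram_law_with_norm ℝ v w
  nlinarith [sq_nonneg ‖v - w‖]

theorem differences_le_var3 (a b : E) (f : E → F) (x : E) :
    ‖f (x + a) - f x‖ ^ 2 + ‖f (x + b) - f x‖ ^ 2 ≤ 4 * var3 a b f x := by
  have h1 := norm_sq_sub_le (f (x + a) - avg3 a b f x) (f x - avg3 a b f x)
  have h2 := norm_sq_sub_le (f (x + b) - avg3 a b f x) (f x - avg3 a b f x)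
  rw [sub_sub_sub_cancel_right] at h1 h2
  unfold var3
  linarith [sq_nonneg ‖f (x + a) - avg3 a b f x‖, sq_nonneg ‖f (x + b) - avg3 a b f x‖]

theorem var3_le_differences (a b : E) (f : E → F) (x : E) :
    var3 a b f x ≤ ‖f (x + a) - f x‖ ^ 2 + ‖f (x + b) - f x‖ ^ 2 := by
  obtain ⟨z, hz⟩ : ∃ z, z = f (x + a) - f x := ⟨_, rfl⟩
  obtain ⟨w, hw⟩ : ∃ w, w = f (x + b) - f x := ⟨_, rfl⟩
  have e : f x - avg3 a b f x = -((1 / 3 : ℝ) • (z + w)) := by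
    rw [avg3_apply, hz, hw]; module
  have ea : f (x + a) - avg3 a b f x = z - (1 / 3 : ℝ) • (z + w) := by
    rw [avg3_apply, hz, hw]; module
  have eb : f (x + b) - avg3 a b f x = w - (1 / 3 : ℝ) • (z + w) := by
    rw [avg3_apply, hz, hw]; module
  rw [var3, e, ea, eb, ← hz, ← hw, norm_neg, norm_sub_sq_real z, norm_sub_sq_real w,
    real_inner_smul_right, real_inner_smul_right, norm_smul, mul_pow, inner_add_right,
    inner_add_right, real_inner_self_eq_norm_sq, real_inner_self_eq_norm_sq,
    real_inner_comm z w, Real.norm_of_nonneg (by norm_num)]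
  have h3 := norm_add_sq_real z w
  nlinarith [sq_nonneg ‖z + w‖]

variable [MeasurableSpace E] [BorelSpace E] (ν : Measure E) [IsFiniteMeasureOnCompacts ν]

variable [ν.IsAddRightInvariant]

theorem integrable_var3 (a b : E) {f : E → F} (hf : Continuous f) (hc : HasCompactSupport f) :
    Integrable (var3 a b f) ν := by
  have h := integrable_norm_sq ν hf hc
  have h1 := ((h.add (h.comp_add_right a)).add (h.comp_add_right b)).sub
    ((integrable_norm_sq ν (continuous_avg3 a b hf) (hasCompactSupport_avg3 a b hc)).const_mul 3)
  refine h1.congr (Filter.Eventually.of_forall fun x => ?_)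
  have := var3_add_norm_sq a b f x
  simp only [Pi.sub_apply, Pi.add_apply]
  linarith

theorem integral_var3 (a b : E) {f : E → F} (hf : Continuous f) (hc : HasCompactSupport f) :
    ∫ x, var3 a b f x ∂ν = 3 * (∫ x, ‖f x‖ ^ 2 ∂ν - ∫ x, ‖avg3 a b f x‖ ^ 2 ∂ν) := by
  have h := integrable_norm_sq ν hf hc
  have h' := integrable_norm_sq ν (continuous_avg3 a b hf) (hasCompactSupport_avg3 a b hc)
  have e : ∫ x, (var3 a b f x + 3 * ‖avg3 a b f x‖ ^ 2) ∂ν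
      = ∫ x, (‖f x‖ ^ 2 + ‖f (x + a)‖ ^ 2 + ‖f (x + b)‖ ^ 2) ∂ν :=
    integral_congr_ae (Filter.Eventually.of_forall (var3_add_norm_sq a b f))
  have h2 : Integrable (fun x => ‖f x‖ ^ 2 + ‖f (x + a)‖ ^ 2) ν := h.add (h.comp_add_right a)
  rw [integral_add (integrable_var3 ν a b hf hc) (h'.const_mul 3), integral_const_mul,
    integral_add h2 (h.comp_add_right b), integral_add h (h.comp_add_right a),
    integral_add_right_eq_self (fun x => ‖f x‖ ^ 2) a,
    integral_add_right_eq_self (fun x => ‖f x‖ ^ 2) b] at e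
  linarith

theorem antitone_integral_avg3_pow (a b : E) {f : E → F} (hf : Continuous f)
    (hc : HasCompactSupport f) : Antitone fun n : ℕ => ∫ x, ‖(avg3 a b ^ n) f x‖ ^ 2 ∂ν := by
  refine antitone_nat_of_succ_le fun n => ?_
  have h := integral_var3 ν a b (continuous_avg3_pow a b hf n) (hasCompactSupport_avg3_pow a b hc n)
  have h0 : 0 ≤ ∫ x, var3 a b ((avg3 a b ^ n) f) x ∂ν := integral_nonneg (var3_nonneg a b _)
  simp only [avg3_pow_succ]
  linarith

theorem integral_avg3_pow_le (a b : E) {f : E → F} (hf : Continuous f)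
    (hc : HasCompactSupport f) (n : ℕ) :
    ∫ x, ‖(avg3 a b ^ n) f x‖ ^ 2 ∂ν ≤ ∫ x, ‖f x‖ ^ 2 ∂ν := by
  simpa using antitone_integral_avg3_pow ν a b hf hc (Nat.zero_le n)

end Variance

theorem integrable_comp_of_hasCompactSupport {E H : Type*} [NormedAddCommGroup E]
    [NormedAddCommGroup H] [MeasurableSpace E] [BorelSpace E] (ν : Measure E)
    [IsFiniteMeasureOnCompacts ν] {W : H → ℝ} (hW0 : W 0 = 0) (hWc : Continuous W) {f : E → H}
    (hf : Continuous f) (hc : HasCompactSupport f) : Integrable (fun x => W (f x)) ν :=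
  (hWc.comp hf).integrable_of_hasCompactSupport (hc.comp_left hW0)

section Averaging

variable {E H H' U : Type*} [NormedAddCommGroup E]
  [NormedAddCommGroup H] [InnerProductSpace ℝ H]
  [NormedAddCommGroup H'] [InnerProductSpace ℝ H']
  [NormedAddCommGroup U] [InnerProductSpace ℝ U]

theorem var3_clm (a b : E) (T : H →L[ℝ] H') (f : E → H) (x : E) :
    var3 a b (fun y => T (f y)) x
      = ‖T (f x - avg3 a b f x)‖ ^ 2 + ‖T (f (x + a) - avg3 a b f x)‖ ^ 2
        + ‖T (f (x + b) - avg3 a b f x)‖ ^ 2 := by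
  have h : avg3 a b (fun y => T (f y)) x = T (avg3 a b f x) := by
    simp only [avg3_apply, map_smul, map_add]
  simp only [var3, h, map_sub]

theorem norm_sub_avg3_le (a b : E) (f : E → H) (x : E) {η : ℝ} (ha : ‖f (x + a) - f x‖ ≤ η)
    (hb : ‖f (x + b) - f x‖ ≤ η) :
    ‖f x - avg3 a b f x‖ ≤ η ∧ ‖f (x + a) - avg3 a b f x‖ ≤ η ∧
      ‖f (x + b) - avg3 a b f x‖ ≤ η := by
  obtain ⟨z, hz⟩ : ∃ z, z = f (x + a) - f x := ⟨_, rfl⟩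
  obtain ⟨w, hw⟩ : ∃ w, w = f (x + b) - f x := ⟨_, rfl⟩
  have e : f x - avg3 a b f x = -((1 / 3 : ℝ) • (z + w)) := by
    rw [avg3_apply, hz, hw]; module
  have ea : f (x + a) - avg3 a b f x = (1 / 3 : ℝ) • (z + z - w) := by
    rw [avg3_apply, hz, hw]; module
  have eb : f (x + b) - avg3 a b f x = (1 / 3 : ℝ) • (w + w - z) := by
    rw [avg3_apply, hz, hw]; module
  rw [← hz] at ha
  rw [← hw] at hb
  rw [e, ea, eb, norm_neg, norm_smul, norm_smul, norm_smul, Real.norm_of_nonneg (by norm_num)]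
  have h1 := norm_add_le z w
  have h2 := norm_sub_le (z + z) w
  have h3 := norm_sub_le (w + w) z
  have h4 := norm_add_le z z
  have h5 := norm_add_le w w
  have := norm_nonneg z
  refine ⟨?_, ?_, ?_⟩ <;> linarith

/-- If the differences of `f` are close to a pair `(Y₁, Y₂)` whose norm is controlled by that of
`(S Y₁, S Y₂)`, then the variance of `f` is controlled by that of `S f`. -/
theorem var3_le_of_coercive {S : H →L[ℝ] H'} (hS : ∀ x, ‖S x‖ ≤ ‖x‖) {K₀ : ℝ} (hK : 0 ≤ K₀)
    {a b : E} {f : E → H} {x : E} {Y₁ Y₂ ρ₁ ρ₂ : H}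
    (hY : ‖Y₁‖ ^ 2 + ‖Y₂‖ ^ 2 ≤ K₀ * (‖S Y₁‖ ^ 2 + ‖S Y₂‖ ^ 2))
    (h₁ : f (x + a) - f x = Y₁ + ρ₁) (h₂ : f (x + b) - f x = Y₂ + ρ₂) :
    var3 a b f x ≤ 16 * K₀ * var3 a b (fun y => S (f y)) x
      + (4 * K₀ + 2) * (‖ρ₁‖ ^ 2 + ‖ρ₂‖ ^ 2) := by
  have h := var3_le_differences a b f x
  have h' := differences_le_var3 a b (fun y => S (f y)) x
  simp only [← map_sub] at h'
  rw [h₁, h₂] at h h'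
  have i1 := norm_sq_add_le Y₁ ρ₁
  have i2 := norm_sq_add_le Y₂ ρ₂
  have j1 := norm_sq_sub_le (S (Y₁ + ρ₁)) (S ρ₁)
  have j2 := norm_sq_sub_le (S (Y₂ + ρ₂)) (S ρ₂)
  rw [← map_sub, add_sub_cancel_right] at j1 j2
  have k1 : ‖S ρ₁‖ ^ 2 ≤ ‖ρ₁‖ ^ 2 := pow_le_pow_left₀ (norm_nonneg _) (hS _) 2
  have k2 : ‖S ρ₂‖ ^ 2 ≤ ‖ρ₂‖ ^ 2 := pow_le_pow_left₀ (norm_nonneg _) (hS _) 2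
  have l : ‖S Y₁‖ ^ 2 + ‖S Y₂‖ ^ 2
      ≤ 8 * var3 a b (fun y => S (f y)) x + 2 * (‖ρ₁‖ ^ 2 + ‖ρ₂‖ ^ 2) := by linarith
  have := mul_le_mul_of_nonneg_left l hK
  linarith

variable {W : H → ℝ} {S : H →L[ℝ] H'} {B C K₀ : ℝ}

theorem three_mul_avg3_le_sum (hS : ∀ x, ‖S x‖ ≤ ‖x‖) (hK : 0 ≤ K₀)
    (hW : ∀ a, ‖a‖ ≤ B → ∃ (G : H →ₗ[ℝ] ℝ) (P : ℝ), 0 ≤ P ∧ P ≤ C ∧ ∀ v, ‖a + v‖ ≤ B →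
      W a + G v + P * (16 * K₀ * ‖S v‖ ^ 2 - ‖v‖ ^ 2) - C * ‖v‖ ^ 3 ≤ W (a + v))
    {a b : E} {f : E → H} (hf : ∀ x, ‖f x‖ ≤ B) {x : E} {Y₁ Y₂ ρ₁ ρ₂ : H}
    (hY : ‖Y₁‖ ^ 2 + ‖Y₂‖ ^ 2 ≤ K₀ * (‖S Y₁‖ ^ 2 + ‖S Y₂‖ ^ 2))
    (h₁ : f (x + a) - f x = Y₁ + ρ₁) (h₂ : f (x + b) - f x = Y₂ + ρ₂) {η : ℝ}
    (ha : ‖f (x + a) - f x‖ ≤ η) (hb : ‖f (x + b) - f x‖ ≤ η) :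
    3 * W (avg3 a b f x)
        - C * (η * var3 a b f x + (4 * K₀ + 2) * (‖ρ₁‖ ^ 2 + ‖ρ₂‖ ^ 2))
      ≤ W (f x) + W (f (x + a)) + W (f (x + b)) := by
  obtain ⟨G, P, hP0, hPC, h⟩ := hW (avg3 a b f x) (avg3_pow_norm_le a b hf 1 x)
  have hv := var3_le_of_coercive hS hK hY h₁ h₂
  rw [var3_clm] at hv
  obtain ⟨n0, n1, n2⟩ := norm_sub_avg3_le a b f x ha hb
  have g : G (f x - avg3 a b f x) + G (f (x + a) - avg3 a b f x)
      + G (f (x + b) - avg3 a b f x) = 0 := by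
    rw [← map_add, ← map_add, avg3_apply]
    convert map_zero G using 2
    module
  have w0 := h (f x - avg3 a b f x) (by simpa using hf x)
  have w1 := h (f (x + a) - avg3 a b f x) (by simpa using hf _)
  have w2 := h (f (x + b) - avg3 a b f x) (by simpa using hf _)
  simp only [add_sub_cancel] at w0 w1 w2
  have hC : 0 ≤ C := hP0.trans hPC
  have hR : 0 ≤ (4 * K₀ + 2) * (‖ρ₁‖ ^ 2 + ‖ρ₂‖ ^ 2) := by positivity
  have q1 := mul_le_mul_of_nonneg_left hv hP0
  have q2 := mul_le_mul_of_nonneg_right hPC hR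
  have cube : ∀ {v : H}, ‖v‖ ≤ η → C * ‖v‖ ^ 3 ≤ C * (η * ‖v‖ ^ 2) := fun {v} hv => by
    refine mul_le_mul_of_nonneg_left ?_ hC
    rw [pow_succ' _ 2]
    exact mul_le_mul_of_nonneg_right hv (sq_nonneg _)
  have c0 := cube n0
  have c1 := cube n1
  have c2 := cube n2
  unfold var3 at q1 ⊢
  linarith

variable [MeasurableSpace E] [BorelSpace E] (ν : Measure E) [IsFiniteMeasureOnCompacts ν]

variable [ν.IsAddRightInvariant]

theorem integral_comp_avg3_le (hS : ∀ x, ‖S x‖ ≤ ‖x‖) (hK : 0 ≤ K₀)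
    (hW0 : W 0 = 0) (hWc : Continuous W)
    (hW : ∀ a, ‖a‖ ≤ B → ∃ (G : H →ₗ[ℝ] ℝ) (P : ℝ), 0 ≤ P ∧ P ≤ C ∧ ∀ v, ‖a + v‖ ≤ B →
      W a + G v + P * (16 * K₀ * ‖S v‖ ^ 2 - ‖v‖ ^ 2) - C * ‖v‖ ^ 3 ≤ W (a + v))
    {a b : E} {f Y₁ Y₂ ρ₁ ρ₂ : E → H} (hf : ∀ x, ‖f x‖ ≤ B)
    (hfc : Continuous f) (hfs : HasCompactSupport f)
    (hρ₁ : Continuous ρ₁) (hρ₁s : HasCompactSupport ρ₁)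
    (hρ₂ : Continuous ρ₂) (hρ₂s : HasCompactSupport ρ₂)
    (hY : ∀ x, ‖Y₁ x‖ ^ 2 + ‖Y₂ x‖ ^ 2 ≤ K₀ * (‖S (Y₁ x)‖ ^ 2 + ‖S (Y₂ x)‖ ^ 2))
    (h₁ : ∀ x, f (x + a) - f x = Y₁ x + ρ₁ x) (h₂ : ∀ x, f (x + b) - f x = Y₂ x + ρ₂ x)
    {η : ℝ} (ha : ∀ x, ‖f (x + a) - f x‖ ≤ η) (hb : ∀ x, ‖f (x + b) - f x‖ ≤ η) :
    ∫ x, W (avg3 a b f x) ∂ν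
        - C * (η * (∫ x, ‖f x‖ ^ 2 ∂ν - ∫ x, ‖avg3 a b f x‖ ^ 2 ∂ν)
          + (4 * K₀ + 2) * (∫ x, ‖ρ₁ x‖ ^ 2 ∂ν + ∫ x, ‖ρ₂ x‖ ^ 2 ∂ν))
      ≤ ∫ x, W (f x) ∂ν := by
  have iW := integrable_comp_of_hasCompactSupport ν hW0 hWc hfc hfs
  have iA := integrable_comp_of_hasCompactSupport ν hW0 hWc (continuous_avg3 a b hfc)
    (hasCompactSupport_avg3 a b hfs)
  have iV := (integrable_var3 ν a b hfc hfs).const_mul η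
  have i1 := integrable_norm_sq ν hρ₁ hρ₁s
  have i2 := integrable_norm_sq ν hρ₂ hρ₂s
  have iR : Integrable (fun x => (4 * K₀ + 2) * (‖ρ₁ x‖ ^ 2 + ‖ρ₂ x‖ ^ 2)) ν :=
    (i1.add i2).const_mul _
  have iW2 : Integrable (fun x => W (f x) + W (f (x + a))) ν := iW.add (iW.comp_add_right a)
  have iE : Integrable (fun x => C * (η * var3 a b f x
      + (4 * K₀ + 2) * (‖ρ₁ x‖ ^ 2 + ‖ρ₂ x‖ ^ 2))) ν := (iV.add iR).const_mul C
  have key : ∫ x, (3 * W (avg3 a b f x) - C * (η * var3 a b f x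
      + (4 * K₀ + 2) * (‖ρ₁ x‖ ^ 2 + ‖ρ₂ x‖ ^ 2))) ∂ν
      ≤ ∫ x, (W (f x) + W (f (x + a)) + W (f (x + b))) ∂ν :=
    integral_mono ((iA.const_mul 3).sub iE) (iW2.add (iW.comp_add_right b)) fun x =>
      three_mul_avg3_le_sum hS hK hW hf (hY x) (h₁ x) (h₂ x) (ha x) (hb x)
  rw [integral_sub (iA.const_mul 3) iE, integral_const_mul, integral_const_mul,
    integral_add iV iR, integral_const_mul, integral_const_mul, integral_add i1 i2,
    integral_var3 ν a b hfc hfs, integral_add iW2 (iW.comp_add_right b),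
    integral_add iW (iW.comp_add_right a),
    integral_add_right_eq_self (fun x => W (f x)) a,
    integral_add_right_eq_self (fun x => W (f x)) b] at key
  have hC : 0 ≤ C := by
    obtain ⟨G, P, h0, h1, -⟩ := hW (f 0) (hf 0)
    exact h0.trans h1
  have hR : 0 ≤ C * ((4 * K₀ + 2) * (∫ x, ‖ρ₁ x‖ ^ 2 ∂ν + ∫ x, ‖ρ₂ x‖ ^ 2 ∂ν)) := by
    have : 0 ≤ ∫ x, ‖ρ₁ x‖ ^ 2 ∂ν := integral_nonneg fun x => sq_nonneg _
    have : 0 ≤ ∫ x, ‖ρ₂ x‖ ^ 2 ∂ν := integral_nonneg fun x => sq_nonneg _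
    positivity
  linarith

/-- The functional `∫ W (f x)` is almost decreased by repeated averaging. -/
theorem integral_comp_avg3_pow_le (hS : ∀ x, ‖S x‖ ≤ ‖x‖) (hK : 0 ≤ K₀)
    (hW0 : W 0 = 0) (hWc : Continuous W)
    (hW : ∀ a, ‖a‖ ≤ B → ∃ (G : H →ₗ[ℝ] ℝ) (P : ℝ), 0 ≤ P ∧ P ≤ C ∧ ∀ v, ‖a + v‖ ≤ B →
      W a + G v + P * (16 * K₀ * ‖S v‖ ^ 2 - ‖v‖ ^ 2) - C * ‖v‖ ^ 3 ≤ W (a + v))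
    {T₁ T₂ : H →L[ℝ] U} (hT : ∀ y₁ y₂, T₂ y₁ = T₁ y₂ →
      ‖y₁‖ ^ 2 + ‖y₂‖ ^ 2 ≤ K₀ * (‖S y₁‖ ^ 2 + ‖S y₂‖ ^ 2))
    {a b : E} {f Y₁ Y₂ ρ₁ ρ₂ : E → H} (hf : ∀ x, ‖f x‖ ≤ B)
    (hfc : Continuous f) (hfs : HasCompactSupport f)
    (hρ₁ : Continuous ρ₁) (hρ₁s : HasCompactSupport ρ₁)
    (hρ₂ : Continuous ρ₂) (hρ₂s : HasCompactSupport ρ₂)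
    (hY : ∀ x, T₂ (Y₁ x) = T₁ (Y₂ x))
    (h₁ : ∀ x, f (x + a) - f x = Y₁ x + ρ₁ x) (h₂ : ∀ x, f (x + b) - f x = Y₂ x + ρ₂ x)
    {η : ℝ} (ha : ∀ x, ‖f (x + a) - f x‖ ≤ η) (hb : ∀ x, ‖f (x + b) - f x‖ ≤ η) (n : ℕ) :
    ∫ x, W ((avg3 a b ^ n) f x) ∂ν
        - C * (η * (∫ x, ‖f x‖ ^ 2 ∂ν - ∫ x, ‖(avg3 a b ^ n) f x‖ ^ 2 ∂ν)
          + n * ((4 * K₀ + 2) * (∫ x, ‖ρ₁ x‖ ^ 2 ∂ν + ∫ x, ‖ρ₂ x‖ ^ 2 ∂ν)))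
      ≤ ∫ x, W (f x) ∂ν := by
  induction n with
  | zero => simp
  | succ n ih =>
    have hY' : ∀ x, T₂ ((avg3 a b ^ n) Y₁ x) = T₁ ((avg3 a b ^ n) Y₂ x) := fun x => by
      have := congrFun (avg3_pow_comp_clm a b T₂ Y₁ n) x
      rw [← this, ← congrFun (avg3_pow_comp_clm a b T₁ Y₂ n) x]
      simp only [hY]
    have exp₁ := avg3_pow_expansion a b a (ContinuousLinearMap.id ℝ H) h₁ n
    have exp₂ := avg3_pow_expansion a b b (ContinuousLinearMap.id ℝ H) h₂ n
    have diff : ∀ c, (∀ x, ‖f (x + c) - f x‖ ≤ η) →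
        ∀ x, ‖(avg3 a b ^ n) f (x + c) - (avg3 a b ^ n) f x‖ ≤ η := fun c hc x => by
      rw [avg3_pow_expansion a b c (ContinuousLinearMap.id ℝ H) (g := 0)
        (ρ := fun x => f (x + c) - f x) (fun x => by simp) n x]
      simpa using avg3_pow_norm_le a b hc n x
    have step := integral_comp_avg3_le ν hS hK hW0 hWc hW (avg3_pow_norm_le a b hf n)
      (continuous_avg3_pow a b hfc n) (hasCompactSupport_avg3_pow a b hfs n)
      (continuous_avg3_pow a b hρ₁ n) (hasCompactSupport_avg3_pow a b hρ₁s n)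
      (continuous_avg3_pow a b hρ₂ n) (hasCompactSupport_avg3_pow a b hρ₂s n)
      (fun x => hT _ _ (hY' x)) exp₁ exp₂ (diff a ha) (diff b hb)
    have r1 := integral_avg3_pow_le ν a b hρ₁ hρ₁s n
    have r2 := integral_avg3_pow_le ν a b hρ₂ hρ₂s n
    have hC : 0 ≤ C := by
      obtain ⟨G, P, h0, h1, -⟩ := hW (f 0) (hf 0)
      exact h0.trans h1
    have r3 := mul_le_mul_of_nonneg_left (add_le_add r1 r2)
      (mul_nonneg hC (show 0 ≤ 4 * K₀ + 2 by positivity))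
    simp only [avg3_pow_succ]
    push_cast
    linarith

end Averaging

section Energy

variable {E H U : Type*} [NormedAddCommGroup E]
  [NormedAddCommGroup H] [InnerProductSpace ℝ H]
  [NormedAddCommGroup U] [InnerProductSpace ℝ U]
  [MeasurableSpace E] [BorelSpace E] (ν : Measure E) [IsFiniteMeasureOnCompacts ν]
  [ν.IsAddRightInvariant]

/-- Energy decay under repeated averaging: if the differences of `u` are close to `(T₁ g, T₂ g)`
then the `L²` norm of the averages of `g` decays. -/
theorem nat_mul_integral_avg3_pow_le {T₁ T₂ : H →L[ℝ] U}
    (hT : ∀ x, ‖x‖ ^ 2 ≤ ‖T₁ x‖ ^ 2 + ‖T₂ x‖ ^ 2) {a b : E} {u σ₁ σ₂ : E → U} {g : E → H}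
    (hu : Continuous u) (hus : HasCompactSupport u)
    (hg : Continuous g) (hgs : HasCompactSupport g)
    (hσ₁ : Continuous σ₁) (hσ₁s : HasCompactSupport σ₁)
    (hσ₂ : Continuous σ₂) (hσ₂s : HasCompactSupport σ₂)
    (h₁ : ∀ x, u (x + a) - u x = T₁ (g x) + σ₁ x)
    (h₂ : ∀ x, u (x + b) - u x = T₂ (g x) + σ₂ x) (n : ℕ) :
    n * ∫ x, ‖(avg3 a b ^ n) g x‖ ^ 2 ∂ν + 24 * ∫ x, ‖(avg3 a b ^ n) u x‖ ^ 2 ∂ν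
      ≤ 24 * ∫ x, ‖u x‖ ^ 2 ∂ν
        + n * (2 * (∫ x, ‖σ₁ x‖ ^ 2 ∂ν + ∫ x, ‖σ₂ x‖ ^ 2 ∂ν)) := by
  induction n with
  | zero => simp
  | succ n ih =>
    have exp₁ := avg3_pow_expansion a b a T₁ h₁ n
    have exp₂ := avg3_pow_expansion a b b T₂ h₂ n
    have pt : ∀ x, ‖(avg3 a b ^ n) g x‖ ^ 2 ≤ 8 * var3 a b ((avg3 a b ^ n) u) x
        + 2 * (‖(avg3 a b ^ n) σ₁ x‖ ^ 2 + ‖(avg3 a b ^ n) σ₂ x‖ ^ 2) := fun x => by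
      have d := differences_le_var3 a b ((avg3 a b ^ n) u) x
      rw [exp₁, exp₂] at d
      have j1 := norm_sq_sub_le (T₁ ((avg3 a b ^ n) g x) + (avg3 a b ^ n) σ₁ x)
        ((avg3 a b ^ n) σ₁ x)
      have j2 := norm_sq_sub_le (T₂ ((avg3 a b ^ n) g x) + (avg3 a b ^ n) σ₂ x)
        ((avg3 a b ^ n) σ₂ x)
      rw [add_sub_cancel_right] at j1 j2
      linarith [hT ((avg3 a b ^ n) g x)]
    have un := continuous_avg3_pow a b hu n
    have uns := hasCompactSupport_avg3_pow a b hus n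
    have i1 := integrable_norm_sq ν (continuous_avg3_pow a b hσ₁ n)
      (hasCompactSupport_avg3_pow a b hσ₁s n)
    have i2 := integrable_norm_sq ν (continuous_avg3_pow a b hσ₂ n)
      (hasCompactSupport_avg3_pow a b hσ₂s n)
    have iR : Integrable (fun x => 2 * (‖(avg3 a b ^ n) σ₁ x‖ ^ 2 + ‖(avg3 a b ^ n) σ₂ x‖ ^ 2)) ν :=
      (i1.add i2).const_mul 2
    have iV := (integrable_var3 ν a b un uns).const_mul 8
    have key := integral_mono (integrable_norm_sq ν (continuous_avg3_pow a b hg n)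
      (hasCompactSupport_avg3_pow a b hgs n)) (iV.add iR) pt
    simp only [Pi.add_apply] at key
    rw [integral_add iV iR, integral_const_mul, integral_const_mul, integral_add i1 i2,
      integral_var3 ν a b un uns] at key
    have r1 := integral_avg3_pow_le ν a b hσ₁ hσ₁s n
    have r2 := integral_avg3_pow_le ν a b hσ₂ hσ₂s n
    have anti := antitone_integral_avg3_pow ν a b hg hgs (Nat.le_succ n)
    simp only [Nat.succ_eq_add_one] at anti
    have m := mul_le_mul_of_nonneg_left anti (show (0 : ℝ) ≤ n + 1 by positivity)
    rw [avg3_pow_succ a b u]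
    push_cast
    linarith

end Energy

section Remainder

variable {E F : Type*} [NormedAddCommGroup E] [NormedSpace ℝ E]
  [NormedAddCommGroup F] [NormedSpace ℝ F]

theorem ContDiff.exists_taylor_bound {f : E → F} (hf : ContDiff ℝ 2 f) (hs : HasCompactSupport f)
    (e : E) : ∃ C : ℝ, 0 ≤ C ∧ ∀ h : ℝ, 0 < h → ∀ x,
      ‖f (x + h • e) - f x‖ ≤ C * h ∧ ‖f (x + h • e) - f x - h • fderiv ℝ f x e‖ ≤ C * h ^ 2 := by
  obtain ⟨K, hK⟩ := (hf.of_le (by norm_num)).lipschitzWith_of_hasCompactSupport hs one_ne_zero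
  have hf' : ContDiff ℝ 1 (fderiv ℝ f) := hf.fderiv_right (by norm_num)
  obtain ⟨L, hL⟩ := hf'.lipschitzWith_of_hasCompactSupport (hs.fderiv ℝ) one_ne_zero
  refine ⟨K * ‖e‖ + L * ‖e‖ ^ 2, by positivity, fun h hh x => ⟨?_, ?_⟩⟩
  · have := hK.norm_sub_le (x + h • e) x
    rw [add_sub_cancel_left, norm_smul, Real.norm_of_nonneg hh.le] at this
    have h2 : 0 ≤ L * ‖e‖ ^ 2 * h := by positivity
    linarith
  · have key := (convex_segment x (x + h • e)).norm_image_sub_le_of_norm_fderiv_le'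
      (f := f) (φ := fderiv ℝ f x) (C := L * ‖h • e‖) (𝕜 := ℝ)
      (fun y _ => (hf.differentiable (by norm_num)) y)
      (fun y hy => by
        refine (hL.norm_sub_le y x).trans ?_
        gcongr
        obtain ⟨t, ht, rfl⟩ := (segment_eq_image' ℝ x (x + h • e)) ▸ hy
        rw [add_sub_cancel_left, add_sub_cancel_left, norm_smul, Real.norm_of_nonneg ht.1]
        exact mul_le_of_le_one_left (norm_nonneg _) ht.2)
      (left_mem_segment ℝ _ _) (right_mem_segment ℝ _ _)
    rw [add_sub_cancel_left, map_smul, norm_smul, Real.norm_of_nonneg hh.le] at key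
    have h2 : 0 ≤ K * ‖e‖ * h ^ 2 := by positivity
    nlinarith

theorem exists_integral_taylor_bound [MeasurableSpace E] [BorelSpace E] (ν : Measure E)
    [IsFiniteMeasureOnCompacts ν] {f : E → F} (hf : ContDiff ℝ 2 f) (hs : HasCompactSupport f)
    (e : E) : ∃ C : ℝ, 0 ≤ C ∧ ∀ h : ℝ, 0 < h → h ≤ 1 →
      (∀ x, ‖f (x + h • e) - f x‖ ≤ C * h) ∧
      Continuous (fun x => f (x + h • e) - f x - h • fderiv ℝ f x e) ∧
      HasCompactSupport (fun x => f (x + h • e) - f x - h • fderiv ℝ f x e) ∧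
      ∫ x, ‖f (x + h • e) - f x - h • fderiv ℝ f x e‖ ^ 2 ∂ν ≤ C * h ^ 4 := by
  obtain ⟨C, hC, hb⟩ := hf.exists_taylor_bound hs e
  set K : Set E := (fun q : E × ℝ => q.1 - q.2 • e) '' (tsupport f ×ˢ Set.Icc (0 : ℝ) 1) with hKdef
  have hK : IsCompact K := (hs.isCompact.prod isCompact_Icc).image (by fun_prop)
  have hfd : Continuous (fderiv ℝ f) := hf.continuous_fderiv (by norm_num)
  refine ⟨C + C ^ 2 * ν.real K, by positivity, fun h h0 h1 => ?_⟩
  have hz : ∀ x ∉ K, f (x + h • e) - f x - h • fderiv ℝ f x e = 0 := fun x hx => by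
    have a1 : x + h • e ∉ tsupport f := fun hm =>
      hx ⟨(x + h • e, h), ⟨hm, h0.le, h1⟩, by simp⟩
    have a2 : x ∉ tsupport f := fun hm => hx ⟨(x, 0), ⟨hm, le_rfl, zero_le_one⟩, by simp⟩
    rw [image_eq_zero_of_notMem_tsupport a1, image_eq_zero_of_notMem_tsupport a2,
      fderiv_of_notMem_tsupport ℝ a2]
    simp
  refine ⟨fun x => ((hb h h0 x).1).trans ?_, ?_, HasCompactSupport.intro hK hz, ?_⟩
  · have : 0 ≤ C ^ 2 * ν.real K * h := by positivity
    linarith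
  · have := hf.continuous
    fun_prop
  · rw [← setIntegral_eq_integral_of_forall_compl_eq_zero (s := K) (fun x hx => by
      rw [hz x hx]; simp)]
    have h2 := norm_setIntegral_le_of_norm_le_const (μ := ν) (s := K)
      (f := fun x => ‖f (x + h • e) - f x - h • fderiv ℝ f x e‖ ^ 2) (C := (C * h ^ 2) ^ 2)
      hK.measure_lt_top (fun x _ => by
        rw [Real.norm_of_nonneg (sq_nonneg _)]
        exact pow_le_pow_left₀ (norm_nonneg _) (hb h h0 x).2 2)
    have h3 : 0 ≤ C * h ^ 4 := by positivity
    calc _ ≤ _ := le_trans (le_abs_self _) h2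
      _ ≤ _ := by linarith

end Remainder

section AbstractKorn

variable {E H H' U : Type*} [NormedAddCommGroup E] [NormedSpace ℝ E]
  [NormedAddCommGroup H] [InnerProductSpace ℝ H]
  [NormedAddCommGroup H'] [InnerProductSpace ℝ H']
  [NormedAddCommGroup U] [InnerProductSpace ℝ U]

theorem exists_kornDensity_zero_quadratic_bound {s d μ : ℝ} (hs : 1 / 2 < s) (hd : 0 < d)
    (hμ : 0 ≤ μ) (S : H →L[ℝ] H') (hS : ∀ x, ‖S x‖ ≤ ‖x‖) (B : ℝ) :
    ∃ C, 0 ≤ C ∧ ∀ v : H, ‖v‖ ≤ B → kornDensity S μ s d 0 - C * ‖v‖ ^ 2 ≤ kornDensity S μ s d v := by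
  obtain ⟨C, hC, h⟩ := exists_weighted_rpow_quadratic_bound B hs hd le_rfl S hS
  have hc : 0 ≤ s * max 1 (2 * s - 1) * d ^ (s - 1) :=
    mul_nonneg (mul_nonneg (by linarith) (zero_le_one.trans (le_max_left _ _)))
      (Real.rpow_nonneg hd.le _)
  refine ⟨2 * (s * max 1 (2 * s - 1) * d ^ (s - 1) + C * |B|), by positivity, fun v hv => ?_⟩
  have h1 := (h 0 v (by simpa using (norm_nonneg v).trans hv) (by simpa using hv)).2
  have h2 : C * ‖v‖ ^ 3 ≤ C * (|B| * ‖v‖ ^ 2) := by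
    refine mul_le_mul_of_nonneg_left ?_ hC
    rw [pow_succ' _ 2]
    exact mul_le_mul_of_nonneg_right (hv.trans (le_abs_self B)) (sq_nonneg _)
  have h3 : d ^ s ≤ (‖v‖ ^ 2 + μ * ‖S v‖ ^ 2 + d) ^ s :=
    Real.rpow_le_rpow hd.le (by have : 0 ≤ ‖v‖ ^ 2 + μ * ‖S v‖ ^ 2 := by positivity
                                linarith) (by linarith)
  simp only [norm_zero, zero_add, zero_mul, add_zero, inner_zero_left, mul_zero, ne_eq,
    OfNat.ofNat_ne_zero, not_false_eq_true, zero_pow] at h1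
  simp only [kornDensity, norm_zero, map_zero, zero_add, mul_zero, ne_eq,
    OfNat.ofNat_ne_zero, not_false_eq_true, zero_pow]
  linarith

theorem continuous_kornDensity (S : H →L[ℝ] H') (μ : ℝ) {s : ℝ} (hs : 0 ≤ s) (d : ℝ) :
    Continuous (kornDensity S μ s d) := by
  unfold kornDensity
  have h1 : Continuous fun a : H => (‖a‖ ^ 2 + μ * ‖S a‖ ^ 2 + d) ^ s :=
    (by fun_prop : Continuous fun a : H => ‖a‖ ^ 2 + μ * ‖S a‖ ^ 2 + d).rpow_const
      fun _ => Or.inr hs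
  have h2 : Continuous fun a : H => (‖a‖ ^ 2 + d) ^ s :=
    (by fun_prop : Continuous fun a : H => ‖a‖ ^ 2 + d).rpow_const fun _ => Or.inr hs
  exact h1.sub (h2.const_mul 2)

variable [MeasurableSpace E] [BorelSpace E] (ν : Measure E) [IsFiniteMeasureOnCompacts ν]
  [ν.IsAddRightInvariant]

theorem integral_comp_gradient_nonneg {W : H → ℝ} {S : H →L[ℝ] H'} {B C C₀ K₀ : ℝ}
    (hS : ∀ x, ‖S x‖ ≤ ‖x‖) (hK : 0 ≤ K₀) (hW0 : W 0 = 0) (hWc : Continuous W) (hC : 0 ≤ C)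
    (hW : ∀ a, ‖a‖ ≤ B → ∃ (G : H →ₗ[ℝ] ℝ) (P : ℝ), 0 ≤ P ∧ P ≤ C ∧ ∀ v, ‖a + v‖ ≤ B →
      W a + G v + P * (16 * K₀ * ‖S v‖ ^ 2 - ‖v‖ ^ 2) - C * ‖v‖ ^ 3 ≤ W (a + v))
    (hC₀ : 0 ≤ C₀) (hWl : ∀ a, ‖a‖ ≤ B → -(C₀ * ‖a‖ ^ 2) ≤ W a)
    {T₁ T₂ : H →L[ℝ] U} (hT : ∀ x, ‖x‖ ^ 2 ≤ ‖T₁ x‖ ^ 2 + ‖T₂ x‖ ^ 2)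
    (hT' : ∀ y₁ y₂, T₂ y₁ = T₁ y₂ → ‖y₁‖ ^ 2 + ‖y₂‖ ^ 2 ≤ K₀ * (‖S y₁‖ ^ 2 + ‖S y₂‖ ^ 2))
    {e₁ e₂ : E} {u : E → U} {X : E → H} (hu : ContDiff ℝ 2 u) (hus : HasCompactSupport u)
    (hX : ContDiff ℝ 2 X) (hXs : HasCompactSupport X) (hXB : ∀ x, ‖X x‖ ≤ B)
    (h₁ : ∀ x, T₁ (X x) = fderiv ℝ u x e₁) (h₂ : ∀ x, T₂ (X x) = fderiv ℝ u x e₂) :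
    0 ≤ ∫ x, W (X x) ∂ν := by
  obtain ⟨C₁, hC₁, b₁⟩ := exists_integral_taylor_bound ν hX hXs e₁
  obtain ⟨C₂, hC₂, b₂⟩ := exists_integral_taylor_bound ν hX hXs e₂
  obtain ⟨C₃, hC₃, b₃⟩ := exists_integral_taylor_bound ν hu hus e₁
  obtain ⟨C₄, hC₄, b₄⟩ := exists_integral_taylor_bound ν hu hus e₂
  set E₀ := ∫ x, ‖u x‖ ^ 2 ∂ν
  set Q₀ := ∫ x, ‖X x‖ ^ 2 ∂ν
  have hE₀ : 0 ≤ E₀ := integral_nonneg fun x => sq_nonneg _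
  have hQ₀ : 0 ≤ Q₀ := integral_nonneg fun x => sq_nonneg _
  set M := C₀ * (24 * E₀ + 2 * (C₃ + C₄))
    + C * ((C₁ + C₂) * Q₀ + (4 * K₀ + 2) * (C₁ + C₂)) with hM
  have hsym : ∀ x, T₂ (fderiv ℝ X x e₁) = T₁ (fderiv ℝ X x e₂) := fun x => by
    have dX : DifferentiableAt ℝ X x := hX.differentiable (by norm_num) x
    have du : DifferentiableAt ℝ (fderiv ℝ u) x :=
      (hu.fderiv_right (m := 1) (by norm_num)).differentiable (by norm_num) x
    have comm : ∀ (T : H →L[ℝ] U) (e v : E), (∀ x, T (X x) = fderiv ℝ u x e) →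
        T (fderiv ℝ X x v) = fderiv ℝ (fderiv ℝ u) x v e := fun T e v hTe => by
      have i1 : HasFDerivAt (fun y => T (X y)) (T ∘L fderiv ℝ X x) x :=
        T.hasFDerivAt.comp x dX.hasFDerivAt
      have i2 : HasFDerivAt (fun y => fderiv ℝ u y e) ((fderiv ℝ (fderiv ℝ u) x).flip e) x := by
        simpa using du.hasFDerivAt.clm_apply (hasFDerivAt_const e x)
      simp only [hTe] at i1
      exact DFunLike.congr_fun (i1.unique i2) v
    rw [comm T₂ e₂ e₁ h₂, comm T₁ e₁ e₂ h₁]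
    exact (hu.contDiffAt.isSymmSndFDerivAt (by simp)).eq _ _
  have key : ∀ m : ℕ, -(M * (1 / ((m : ℝ) + 1))) ≤ ∫ x, W (X x) ∂ν := fun m => by
    set h : ℝ := 1 / ((m : ℝ) + 1) with hh
    have h0 : 0 < h := by positivity
    have h1 : h ≤ 1 := by rw [hh, div_le_one (by positivity)]; linarith [m.cast_nonneg (α := ℝ)]
    have hinv : ((m : ℝ) + 1) * h = 1 := by rw [hh]; field_simp
    obtain ⟨d₁, c₁, s₁, r₁⟩ := b₁ h h0 h1
    obtain ⟨d₂, c₂, s₂, r₂⟩ := b₂ h h0 h1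
    obtain ⟨-, c₃, s₃, r₃⟩ := b₃ h h0 h1
    obtain ⟨-, c₄, s₄, r₄⟩ := b₄ h h0 h1
    set n := (m + 1) ^ 3 with hn
    have hnh4 : (n : ℝ) * h ^ 4 = h := by
      rw [hn]; push_cast
      calc ((m : ℝ) + 1) ^ 3 * h ^ 4 = (((m : ℝ) + 1) * h) ^ 3 * h := by ring
        _ = h := by rw [hinv]; ring
    have hnh3 : (n : ℝ) * h ^ 3 = 1 := by
      rw [hn]; push_cast
      calc ((m : ℝ) + 1) ^ 3 * h ^ 3 = (((m : ℝ) + 1) * h) ^ 3 := by ring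
        _ = 1 := by rw [hinv]; ring
    have J := integral_comp_avg3_pow_le ν hS hK hW0 hWc hW hT'
      (a := h • e₁) (b := h • e₂) (Y₁ := fun x => h • fderiv ℝ X x e₁)
      (Y₂ := fun x => h • fderiv ℝ X x e₂) (η := (C₁ + C₂) * h) hXB hX.continuous hXs c₁ s₁ c₂ s₂
      (fun x => by simp only [map_smul, hsym]) (fun x => by abel) (fun x => by abel)
      (fun x => (d₁ x).trans (by gcongr; linarith)) (fun x => (d₂ x).trans (by gcongr; linarith)) n
    have D := nat_mul_integral_avg3_pow_le ν hT (a := h • e₁) (b := h • e₂) (u := u)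
      (g := h • X) hu.continuous hus (hX.continuous.const_smul h) (hXs.smul_left (f := fun _ => h))
      c₃ s₃ c₄ s₄ (fun x => by simp [h₁]) (fun x => by simp [h₂]) n
    set Q := ∫ x, ‖(avg3 (h • e₁) (h • e₂) ^ n) X x‖ ^ 2 ∂ν with hQ
    have hQ0 : 0 ≤ Q := integral_nonneg fun x => sq_nonneg _
    have e1 : ∫ x, ‖(avg3 (h • e₁) (h • e₂) ^ n) (h • X) x‖ ^ 2 ∂ν = h ^ 2 * Q := by
      rw [hQ, ← integral_const_mul]
      congr 1 with x
      rw [map_smul, Pi.smul_apply, norm_smul, mul_pow, Real.norm_of_nonneg h0.le]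
    have e2 : 0 ≤ ∫ x, ‖(avg3 (h • e₁) (h • e₂) ^ n) u x‖ ^ 2 ∂ν :=
      integral_nonneg fun x => sq_nonneg _
    have hQle : Q ≤ (24 * E₀ + 2 * (C₃ + C₄)) * h := by
      have f1 := mul_le_mul_of_nonneg_left (add_le_add r₃ r₄) (show 0 ≤ (n : ℝ) * 2 by positivity)
      rw [e1] at D
      have f2 : n * (h ^ 2 * Q) ≤ 24 * E₀ + 2 * (C₃ + C₄) * h := by
        calc n * (h ^ 2 * Q) ≤ 24 * E₀ + 2 * (C₃ + C₄) * (n * h ^ 4) := by linarith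
          _ = _ := by rw [hnh4]
      have f3 := mul_le_mul_of_nonneg_left f2 h0.le
      have f4 : h * (n * (h ^ 2 * Q)) = Q := by
        calc _ = (n * h ^ 3) * Q := by ring
          _ = Q := by rw [hnh3, one_mul]
      have f5 : 2 * (C₃ + C₄) * h * h ≤ 2 * (C₃ + C₄) * h * 1 := by gcongr
      linarith
    have L : -(C₀ * Q) ≤ ∫ x, W ((avg3 (h • e₁) (h • e₂) ^ n) X x) ∂ν := by
      rw [hQ, ← integral_const_mul, ← integral_neg]
      have g1 := continuous_avg3_pow (h • e₁) (h • e₂) hX.continuous n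
      have g2 := hasCompactSupport_avg3_pow (h • e₁) (h • e₂) hXs n
      exact integral_mono ((integrable_norm_sq ν g1 g2).const_mul C₀).neg
        (integrable_comp_of_hasCompactSupport ν hW0 hWc g1 g2)
        fun x => hWl _ (avg3_pow_norm_le _ _ hXB n x)
    have f6 := mul_le_mul_of_nonneg_left hQle hC₀
    have f7 := mul_le_mul_of_nonneg_left (add_le_add r₁ r₂)
      (show 0 ≤ C * (n * (4 * K₀ + 2)) by positivity)
    have f8 : C * (n * (4 * K₀ + 2)) * (C₁ * h ^ 4 + C₂ * h ^ 4)
        = C * ((4 * K₀ + 2) * (C₁ + C₂)) * h := by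
      calc _ = C * ((4 * K₀ + 2) * (C₁ + C₂)) * (n * h ^ 4) := by ring
        _ = _ := by rw [hnh4]
    have f9 : 0 ≤ C * ((C₁ + C₂) * h * Q) := by positivity
    rw [hM]
    linarith
  have lim : Filter.Tendsto (fun m : ℕ => -(M * (1 / ((m : ℝ) + 1)))) Filter.atTop
      (nhds (-(M * 0))) := (tendsto_one_div_add_atTop_nhds_zero_nat.const_mul M).neg
  simpa using le_of_tendsto' lim key

end AbstractKorn

theorem exists_add_rpow_le {s : ℝ} (hs : 0 < s) {μ : ℝ} (hμ : 0 ≤ μ) :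
    ∃ C : ℝ, 0 ≤ C ∧ ∀ x y : ℝ, 0 ≤ x → 0 ≤ y →
      (x + μ * y) ^ s ≤ 3 / 2 * x ^ s + C * y ^ s := by
  set c : ℝ := (3 / 2) ^ s⁻¹ with hc
  have hc1 : 1 < c := Real.one_lt_rpow (by norm_num) (by positivity)
  have hcs : c ^ s = 3 / 2 := by rw [hc, Real.rpow_inv_rpow (by norm_num) hs.ne']
  have hk : 0 ≤ μ / (c - 1) + μ := add_nonneg (div_nonneg hμ (by linarith)) hμ
  refine ⟨(μ / (c - 1) + μ) ^ s, Real.rpow_nonneg hk _, fun x y hx hy => ?_⟩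
  rcases le_total (μ * y) ((c - 1) * x) with h | h
  · have h1 : (x + μ * y) ^ s ≤ (c * x) ^ s :=
      Real.rpow_le_rpow (by positivity) (by linarith) hs.le
    rw [Real.mul_rpow (by linarith) hx, hcs] at h1
    have : 0 ≤ (μ / (c - 1) + μ) ^ s * y ^ s :=
      mul_nonneg (Real.rpow_nonneg hk _) (Real.rpow_nonneg hy _)
    linarith
  · have h0 : x ≤ μ / (c - 1) * y := by
      rw [div_mul_eq_mul_div, le_div_iff₀ (by linarith)]
      linarith
    have h1 : (x + μ * y) ^ s ≤ ((μ / (c - 1) + μ) * y) ^ s :=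
      Real.rpow_le_rpow (by positivity) (by linarith) hs.le
    rw [Real.mul_rpow hk hy] at h1
    have := Real.rpow_nonneg hx s
    linarith

section AbstractKorn

variable {E H H' U : Type*} [NormedAddCommGroup E]
  [NormedAddCommGroup H] [InnerProductSpace ℝ H]
  [NormedAddCommGroup H'] [InnerProductSpace ℝ H']
  [NormedAddCommGroup U] [InnerProductSpace ℝ U]
  [MeasurableSpace E] [BorelSpace E] (ν : Measure E) [IsFiniteMeasureOnCompacts ν]

theorem integral_kornDensity_zero_nonneg {S : H →L[ℝ] H'} {μ s : ℝ} (hμ : 0 ≤ μ) (hs : 0 < s)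
    {X : E → H} (hX : Continuous X) (hXs : HasCompactSupport X)
    (h : ∀ d : ℝ, 0 < d → 0 ≤ ∫ x, (kornDensity S μ s d (X x) - kornDensity S μ s d 0) ∂ν) :
    0 ≤ ∫ x, kornDensity S μ s 0 (X x) ∂ν := by
  obtain ⟨M, hM⟩ : ∃ M : ℝ, ∀ x, ‖X x‖ ^ 2 + μ * ‖S (X x)‖ ^ 2 ≤ M := by
    have hc : HasCompactSupport fun x => ‖X x‖ ^ 2 + μ * ‖S (X x)‖ ^ 2 :=
      hXs.comp_left (g := fun y => ‖y‖ ^ 2 + μ * ‖S y‖ ^ 2) (by simp)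
    obtain ⟨M, hM⟩ := hc.exists_bound_of_continuous (by fun_prop)
    exact ⟨M, fun x => (le_abs_self _).trans (hM x)⟩
  have nn : ∀ x, 0 ≤ μ * ‖S (X x)‖ ^ 2 := fun x => by positivity
  set K := tsupport X
  have lim : Filter.Tendsto (fun m : ℕ => ∫ x, (kornDensity S μ s (1 / ((m : ℝ) + 1)) (X x)
      - kornDensity S μ s (1 / ((m : ℝ) + 1)) 0) ∂ν) Filter.atTop
      (nhds (∫ x, (kornDensity S μ s 0 (X x) - kornDensity S μ s 0 0) ∂ν)) := by
    refine tendsto_integral_of_dominated_convergence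
      (K.indicator fun _ => 6 * (M + 1) ^ s) (fun m => ?_) ?_ (fun m => ?_) ?_
    · exact (integrable_comp_of_hasCompactSupport ν
        (W := fun a => kornDensity S μ s (1 / ((m : ℝ) + 1)) a
          - kornDensity S μ s (1 / ((m : ℝ) + 1)) 0) (sub_self _)
        ((continuous_kornDensity S μ hs.le _).sub continuous_const) hX hXs).aestronglyMeasurable
    · exact (integrableOn_const hXs.isCompact.measure_lt_top.ne).integrable_indicator
        (isClosed_tsupport X).measurableSet
    · refine Filter.Eventually.of_forall fun x => ?_
      by_cases hx : x ∈ K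
      · rw [Set.indicator_of_mem hx]
        have hd0 : (0 : ℝ) ≤ 1 / ((m : ℝ) + 1) := by positivity
        have hd1 : 1 / ((m : ℝ) + 1) ≤ 1 := by
          rw [div_le_one (by positivity)]; linarith [m.cast_nonneg (α := ℝ)]
        set d := 1 / ((m : ℝ) + 1)
        have bd : ∀ t : ℝ, 0 ≤ t → t ≤ M + 1 → 0 ≤ t ^ s ∧ t ^ s ≤ (M + 1) ^ s := fun t h0 h1 =>
          ⟨Real.rpow_nonneg h0 _, Real.rpow_le_rpow h0 h1 hs.le⟩
        have hx0 := sq_nonneg ‖X x‖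
        obtain ⟨a1, a2⟩ := bd (‖X x‖ ^ 2 + μ * ‖S (X x)‖ ^ 2 + d) (by linarith [nn x])
          (by linarith [hM x])
        obtain ⟨b1, b2⟩ := bd (‖X x‖ ^ 2 + d) (by linarith [nn x]) (by linarith [hM x, nn x])
        obtain ⟨c1, c2⟩ := bd d hd0 (by linarith [hM x, nn x])
        simp only [kornDensity, norm_zero, map_zero, zero_add, mul_zero, ne_eq,
          OfNat.ofNat_ne_zero, not_false_eq_true, zero_pow, Real.norm_eq_abs, abs_le]
        constructor <;> linarith
      · rw [Set.indicator_of_notMem hx, image_eq_zero_of_notMem_tsupport hx]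
        simp
    · refine Filter.Eventually.of_forall fun x => ?_
      have hcont : ∀ a : H, Continuous fun d : ℝ => kornDensity S μ s d a := fun a => by
        unfold kornDensity
        have h1 : Continuous fun d : ℝ => (‖a‖ ^ 2 + μ * ‖S a‖ ^ 2 + d) ^ s :=
          (by fun_prop : Continuous fun d : ℝ => ‖a‖ ^ 2 + μ * ‖S a‖ ^ 2 + d).rpow_const
            fun _ => Or.inr hs.le
        have h2 : Continuous fun d : ℝ => (‖a‖ ^ 2 + d) ^ s :=
          (by fun_prop : Continuous fun d : ℝ => ‖a‖ ^ 2 + d).rpow_const fun _ => Or.inr hs.le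
        exact h1.sub (h2.const_mul 2)
      exact (((hcont (X x)).sub (hcont 0)).tendsto 0).comp tendsto_one_div_add_atTop_nhds_zero_nat
  have h0 := ge_of_tendsto' lim fun m => h _ (by positivity)
  have z : kornDensity S μ s 0 0 = 0 := by simp [kornDensity, hs.ne']
  simpa [z] using h0

variable [NormedSpace ℝ E] [ν.IsAddRightInvariant]

/-- An abstract Korn inequality for smooth compactly supported functions. The vector field `X` plays
the role of the gradient of `u`, with partial derivatives `T₁ X` and `T₂ X`, and `S` is the
projection on symmetric gradients. -/
theorem exists_integral_gradient_rpow_le {p K₀ : ℝ} (hp : 1 < p) (hK : 0 ≤ K₀)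
    {S : H →L[ℝ] H'} (hS : ∀ x, ‖S x‖ ≤ ‖x‖)
    {T₁ T₂ : H →L[ℝ] U} (hT : ∀ x, ‖x‖ ^ 2 ≤ ‖T₁ x‖ ^ 2 + ‖T₂ x‖ ^ 2)
    (hT' : ∀ y₁ y₂, T₂ y₁ = T₁ y₂ → ‖y₁‖ ^ 2 + ‖y₂‖ ^ 2 ≤ K₀ * (‖S y₁‖ ^ 2 + ‖S y₂‖ ^ 2))
    (e₁ e₂ : E) :
    ∃ C : ℝ, 0 ≤ C ∧ ∀ (u : E → U) (X : E → H), ContDiff ℝ 2 u → HasCompactSupport u →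
      ContDiff ℝ 2 X → HasCompactSupport X → (∀ x, T₁ (X x) = fderiv ℝ u x e₁) →
      (∀ x, T₂ (X x) = fderiv ℝ u x e₂) →
      ∫ x, ‖X x‖ ^ p ∂ν ≤ C * ∫ x, ‖S (X x)‖ ^ p ∂ν := by
  have hs : 1 / 2 < p / 2 := by linarith
  have hs0 : 0 < p / 2 := by linarith
  obtain ⟨μ, hμ, hμW⟩ := exists_kornDensity_lower_bound (H := H) (H' := H') hs (16 * K₀)
  obtain ⟨A, hA, hAle⟩ := exists_add_rpow_le hs0 hμ
  refine ⟨2 * A, by positivity, fun u X hu hus hX hXs h₁ h₂ => ?_⟩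
  obtain ⟨B, hB⟩ := hXs.exists_bound_of_continuous hX.continuous
  have hnn : 0 ≤ ∫ x, kornDensity S μ (p / 2) 0 (X x) ∂ν := by
    refine integral_kornDensity_zero_nonneg ν hμ hs0 hX.continuous hXs fun d hd => ?_
    obtain ⟨C, hC, hW⟩ := hμW S hS d hd B
    obtain ⟨C₀, hC₀, hW₀⟩ := exists_kornDensity_zero_quadratic_bound hs hd hμ S hS B
    refine integral_comp_gradient_nonneg ν
      (W := fun a => kornDensity S μ (p / 2) d a - kornDensity S μ (p / 2) d 0) hS hK (sub_self _)
      ((continuous_kornDensity S μ hs0.le d).sub continuous_const) hC (fun a ha => ?_) hC₀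
      (fun a ha => by linarith [hW₀ a ha]) hT hT' hu hus hX hXs hB h₁ h₂
    obtain ⟨G, P, h0, hP, h⟩ := hW a ha
    exact ⟨G, P, h0, hP, fun v hv => by linarith [h v hv]⟩
  have rp : ∀ t : ℝ, 0 ≤ t → (t ^ 2) ^ (p / 2) = t ^ p := fun t ht => by
    rw [← Real.rpow_natCast, ← Real.rpow_mul ht]
    congr 1
    push_cast
    ring
  have i1 : Integrable (fun x => ‖X x‖ ^ p) ν :=
    integrable_comp_of_hasCompactSupport ν (W := fun y : H => ‖y‖ ^ p)
      (by simp [(zero_lt_one.trans hp).ne'])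
      (continuous_norm.rpow_const fun _ => Or.inr (by linarith)) hX.continuous hXs
  have i2 : Integrable (fun x => ‖S (X x)‖ ^ p) ν :=
    integrable_comp_of_hasCompactSupport ν (W := fun y : H => ‖S y‖ ^ p)
      (by simp [(zero_lt_one.trans hp).ne'])
      (S.continuous.norm.rpow_const fun _ => Or.inr (by linarith)) hX.continuous hXs
  have i3 : Integrable (fun x => kornDensity S μ (p / 2) 0 (X x)) ν :=
    integrable_comp_of_hasCompactSupport ν (by simp [kornDensity, hs0.ne'])
      (continuous_kornDensity S μ hs0.le 0) hX.continuous hXs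
  have hle := integral_mono i3 ((i2.const_mul A).sub (i1.const_mul (1 / 2))) fun x => by
    have h1 := hAle (‖X x‖ ^ 2) (‖S (X x)‖ ^ 2) (sq_nonneg _) (sq_nonneg _)
    rw [rp _ (norm_nonneg _), rp _ (norm_nonneg _)] at h1
    simp only [kornDensity, add_zero, Pi.sub_apply]
    rw [rp _ (norm_nonneg _)]
    linarith
  simp only [Pi.sub_apply] at hle
  rw [integral_sub (i2.const_mul A) (i1.const_mul (1 / 2)), integral_const_mul,
    integral_const_mul] at hle
  linarith

end AbstractKorn

section Plane

/-- The vector of the entries of the matrix of a linear map of the plane. -/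
noncomputable def gradVec : (ℝ × ℝ →L[ℝ] ℝ × ℝ) →L[ℝ] EuclideanSpace ℝ (Fin 4) :=
  LinearMap.toContinuousLinearMap
    { toFun := fun L => !₂[(L (1, 0)).1, (L (0, 1)).1, (L (1, 0)).2, (L (0, 1)).2]
      map_add' := fun L M => by ext i; fin_cases i <;> simp
      map_smul' := fun c L => by ext i; fin_cases i <;> simp }

/-- The symmetrisation of a matrix, in terms of its vector of entries. -/
noncomputable def symVec : EuclideanSpace ℝ (Fin 4) →L[ℝ] EuclideanSpace ℝ (Fin 4) :=
  LinearMap.toContinuousLinearMap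
    { toFun := fun x => !₂[x 0, (x 1 + x 2) / 2, (x 1 + x 2) / 2, x 3]
      map_add' := fun x y => by ext i; fin_cases i <;> simp <;> ring
      map_smul' := fun c x => by ext i; fin_cases i <;> simp <;> ring }

/-- The first column of a matrix, in terms of its vector of entries. -/
noncomputable def fstCol : EuclideanSpace ℝ (Fin 4) →L[ℝ] EuclideanSpace ℝ (Fin 2) :=
  LinearMap.toContinuousLinearMap
    { toFun := fun x => !₂[x 0, x 2]
      map_add' := fun x y => by ext i; fin_cases i <;> simp
      map_smul' := fun c x => by ext i; fin_cases i <;> simp }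

/-- The second column of a matrix, in terms of its vector of entries. -/
noncomputable def sndCol : EuclideanSpace ℝ (Fin 4) →L[ℝ] EuclideanSpace ℝ (Fin 2) :=
  LinearMap.toContinuousLinearMap
    { toFun := fun x => !₂[x 1, x 3]
      map_add' := fun x y => by ext i; fin_cases i <;> simp
      map_smul' := fun c x => by ext i; fin_cases i <;> simp }

/-- The identification of `ℝ × ℝ` with the Euclidean plane. -/
noncomputable def toPlane : ℝ × ℝ →L[ℝ] EuclideanSpace ℝ (Fin 2) :=
  LinearMap.toContinuousLinearMap
    { toFun := fun x => !₂[x.1, x.2]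
      map_add' := fun x y => by ext i; fin_cases i <;> simp
      map_smul' := fun c x => by ext i; fin_cases i <;> simp }

theorem gradVec_apply (L : ℝ × ℝ →L[ℝ] ℝ × ℝ) :
    gradVec L = !₂[(L (1, 0)).1, (L (0, 1)).1, (L (1, 0)).2, (L (0, 1)).2] := rfl

theorem symVec_apply (x : EuclideanSpace ℝ (Fin 4)) :
    symVec x = !₂[x 0, (x 1 + x 2) / 2, (x 1 + x 2) / 2, x 3] := rfl

theorem fstCol_apply (x : EuclideanSpace ℝ (Fin 4)) : fstCol x = !₂[x 0, x 2] := rfl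

theorem sndCol_apply (x : EuclideanSpace ℝ (Fin 4)) : sndCol x = !₂[x 1, x 3] := rfl

theorem toPlane_apply (x : ℝ × ℝ) : toPlane x = !₂[x.1, x.2] := rfl

theorem frobNorm_jacMat (u : ℝ × ℝ → ℝ × ℝ) (y : ℝ × ℝ) :
    frobNorm (jacMat u y) = ‖gradVec (fderiv ℝ u y)‖ := by
  rw [EuclideanSpace.norm_eq, frobNorm]
  simp [Fin.sum_univ_four, Fin.sum_univ_two, jacMat, gradVec_apply, add_assoc]

theorem frobNorm_symPart_jacMat (u : ℝ × ℝ → ℝ × ℝ) (y : ℝ × ℝ) :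
    frobNorm (symPart (jacMat u y)) = ‖symVec (gradVec (fderiv ℝ u y))‖ := by
  rw [EuclideanSpace.norm_eq, frobNorm]
  congr 1
  simp [Fin.sum_univ_four, Fin.sum_univ_two, jacMat, gradVec_apply, symVec_apply, symPart]
  ring

theorem norm_symVec_le (x : EuclideanSpace ℝ (Fin 4)) : ‖symVec x‖ ≤ ‖x‖ := by
  rw [← sq_le_sq₀ (norm_nonneg _) (norm_nonneg _), EuclideanSpace.norm_sq_eq,
    EuclideanSpace.norm_sq_eq]
  simp only [Fin.sum_univ_four, symVec_apply, Real.norm_eq_abs, sq_abs]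
  simp
  nlinarith [sq_nonneg (x 1 - x 2)]

theorem norm_sq_eq_fstCol_add_sndCol (x : EuclideanSpace ℝ (Fin 4)) :
    ‖x‖ ^ 2 = ‖fstCol x‖ ^ 2 + ‖sndCol x‖ ^ 2 := by
  simp only [EuclideanSpace.norm_sq_eq, Fin.sum_univ_four, Fin.sum_univ_two, fstCol_apply,
    sndCol_apply, Real.norm_eq_abs, sq_abs]
  simp
  ring

/-- A field of second derivatives is controlled by its symmetrised part. -/
theorem norm_sq_le_symVec_of_compatible (y z : EuclideanSpace ℝ (Fin 4))
    (h : sndCol y = fstCol z) :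
    ‖y‖ ^ 2 + ‖z‖ ^ 2 ≤ 4 * (‖symVec y‖ ^ 2 + ‖symVec z‖ ^ 2) := by
  have h0 : y 1 = z 0 := by simpa [sndCol_apply, fstCol_apply] using congrArg (fun v => v 0) h
  have h1 : y 3 = z 2 := by simpa [sndCol_apply, fstCol_apply] using congrArg (fun v => v 1) h
  simp only [EuclideanSpace.norm_sq_eq, Fin.sum_univ_four, symVec_apply, Real.norm_eq_abs, sq_abs]
  simp
  rw [← h0, h1]
  nlinarith [sq_nonneg (y 1 + y 2 + y 1), sq_nonneg (z 1 + z 2 + z 2), sq_nonneg (y 0),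
    sq_nonneg (z 3)]

theorem exists_integral_gradVec_rpow_le_of_contDiff {p : ℝ} (hp : 1 < p) :
    ∃ C : ℝ, 0 ≤ C ∧ ∀ u : ℝ × ℝ → ℝ × ℝ, ContDiff ℝ 3 u → HasCompactSupport u →
      ∫ y, ‖gradVec (fderiv ℝ u y)‖ ^ p ≤ C * ∫ y, ‖symVec (gradVec (fderiv ℝ u y))‖ ^ p := by
  obtain ⟨C, hC, h⟩ := exists_integral_gradient_rpow_le (volume : Measure (ℝ × ℝ)) hp
    (by norm_num : (0 : ℝ) ≤ 4) norm_symVec_le (fun x => (norm_sq_eq_fstCol_add_sndCol x).le)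
    norm_sq_le_symVec_of_compatible (1, 0) (0, 1)
  refine ⟨C, hC, fun u hu hus => ?_⟩
  have hd : ∀ x, HasFDerivAt (fun y => toPlane (u y)) (toPlane ∘L fderiv ℝ u x) x := fun x =>
    toPlane.hasFDerivAt.comp x (hu.differentiable (by norm_num) x).hasFDerivAt
  refine h (fun y => toPlane (u y)) (fun y => gradVec (fderiv ℝ u y))
    (toPlane.contDiff.comp (hu.of_le (by norm_num))) (hus.comp_left (map_zero toPlane))
    (gradVec.contDiff.comp (hu.fderiv_right (by norm_num)))
    ((hus.fderiv ℝ).comp_left (map_zero gradVec)) (fun x => ?_) (fun x => ?_)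
  · rw [(hd x).fderiv]
    simp [fstCol_apply, gradVec_apply, toPlane_apply]
  · rw [(hd x).fderiv]
    simp [sndCol_apply, gradVec_apply, toPlane_apply]

end Plane

section Mollification

open Filter Topology

variable {E F : Type*} [NormedAddCommGroup E] [NormedSpace ℝ E] [FiniteDimensional ℝ E]
  [MeasurableSpace E] [BorelSpace E]
  [NormedAddCommGroup F] [NormedSpace ℝ F] [FiniteDimensional ℝ F]
  (ν : Measure E)

theorem aestronglyMeasurable_fderiv (u : E → F) : AEStronglyMeasurable (fderiv ℝ u) ν := by
  borelize (E →L[ℝ] F)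
  exact (measurable_fderiv ℝ u).aestronglyMeasurable

variable [ν.IsAddHaarMeasure]

theorem LipschitzWith.hasFDerivAt_convolution {φ : E → ℝ} {u : E → F} {K : NNReal}
    (hu : LipschitzWith K u) (hφ : Continuous φ) (hφs : HasCompactSupport φ) (x : E) :
    HasFDerivAt (convolution φ u (ContinuousLinearMap.lsmul ℝ ℝ) ν)
      (convolution φ (fderiv ℝ u) (ContinuousLinearMap.lsmul ℝ ℝ) ν x) x := by
  have hsub : ∀ x : E, Measure.QuasiMeasurePreserving (fun t => x - t) ν ν := fun x =>
    (Measure.measurePreserving_sub_left ν x).quasiMeasurePreserving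
  have hd : ∀ᵐ t ∂ν, DifferentiableAt ℝ u (x - t) := (hsub x).ae hu.ae_differentiableAt
  have hc : ∀ x, Continuous fun t => φ t • u (x - t) := fun x => by
    have := hu.continuous
    fun_prop
  refine (hasFDerivAt_integral_of_dominated_loc_of_lip (𝕜 := ℝ) (s := Set.univ)
    (F := fun x t => φ t • u (x - t)) (F' := fun t => φ t • fderiv ℝ u (x - t))
    (bound := fun t => ‖φ t‖ * K) univ_mem
    (Eventually.of_forall fun x => (hc x).aestronglyMeasurable)
    ((hc x).integrable_of_hasCompactSupport hφs.smul_right)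
    (hφ.aestronglyMeasurable.smul
      ((aestronglyMeasurable_fderiv ν u).comp_quasiMeasurePreserving (hsub x)))
    (Eventually.of_forall fun t => ?_)
    ((hφ.integrable_of_hasCompactSupport hφs).norm.mul_const _) ?_).2
  · refine LipschitzWith.lipschitzOnWith (LipschitzWith.of_dist_le_mul fun y z => ?_)
    rw [dist_eq_norm, ← smul_sub, norm_smul]
    have h := hu.dist_le_mul (y - t) (z - t)
    rw [dist_sub_right, dist_eq_norm] at h
    calc ‖φ t‖ * ‖u (y - t) - u (z - t)‖ ≤ ‖φ t‖ * (K * dist y z) := by gcongr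
      _ = |‖φ t‖ * K| * dist y z := by rw [abs_of_nonneg (by positivity), mul_assoc]
      _ = _ := by simp
  · filter_upwards [hd] with t ht
    have h1 : HasFDerivAt (fun y => u (y - t)) (fderiv ℝ u (x - t)) x := by
      simpa [Function.comp_def] using ht.hasFDerivAt.comp x ((hasFDerivAt_id x).sub_const t)
    exact h1.const_smul (φ t)

/-- A Lipschitz function with compact support can be approximated by smooth compactly supported
functions in such a way that integrals of continuous functions of the gradient converge. -/
theorem LipschitzWith.exists_contDiff_tendsto_integral_fderiv {u : E → F} {K : NNReal}
    (hu : LipschitzWith K u) (hus : HasCompactSupport u) :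
    ∃ v : ℕ → E → F, (∀ k, ContDiff ℝ 3 (v k)) ∧ (∀ k, HasCompactSupport (v k)) ∧
      ∀ Φ : (E →L[ℝ] F) → ℝ, Continuous Φ → Φ 0 = 0 →
        Tendsto (fun k => ∫ x, Φ (fderiv ℝ (v k) x) ∂ν) atTop (𝓝 (∫ x, Φ (fderiv ℝ u x) ∂ν)) := by
  let φ : ℕ → ContDiffBump (0 : E) := fun k =>
    { rIn := 1 / ((k : ℝ) + 1) / 2
      rOut := 1 / ((k : ℝ) + 1)
      rIn_pos := by positivity
      rIn_lt_rOut := half_lt_self (by positivity) }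
  have hφ1 : ∀ k, (φ k).rOut ≤ 1 := fun k => by
    simp only [φ]
    rw [div_le_one (by positivity)]
    linarith [k.cast_nonneg (α := ℝ)]
  let v : ℕ → E → F := fun k => convolution ((φ k).normed ν) u (ContinuousLinearMap.lsmul ℝ ℝ) ν
  have hder : ∀ k x, fderiv ℝ (v k) x = convolution ((φ k).normed ν) (fderiv ℝ u)
      (ContinuousLinearMap.lsmul ℝ ℝ) ν x := fun k x =>
    (hu.hasFDerivAt_convolution ν (φ k).continuous_normed (φ k).hasCompactSupport_normed x).fderiv
  have hsm : ∀ k, ContDiff ℝ 3 (v k) := fun k =>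
    (φ k).hasCompactSupport_normed.contDiff_convolution_left (n := 3) _ (φ k).contDiff_normed
      hu.continuous.locallyIntegrable
  refine ⟨v, hsm, fun k => (φ k).hasCompactSupport_normed.convolution _ hus, fun Φ hΦ h0 => ?_⟩
  have hbd : ∀ x, ‖fderiv ℝ u x‖ ≤ K := fun x => norm_fderiv_le_of_lipschitz ℝ hu
  have hloc : LocallyIntegrable (fderiv ℝ u) ν :=
    (locallyIntegrable_const (K : ℝ)).mono (aestronglyMeasurable_fderiv ν u)
      (Eventually.of_forall fun x => by simpa using hbd x)
  have hae := ContDiffBump.ae_convolution_tendsto_right_of_locallyIntegrable (φ := φ) (K := 2)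
    (l := atTop) (μ := ν) (by simpa [φ] using tendsto_one_div_add_atTop_nhds_zero_nat (𝕜 := ℝ))
    (Eventually.of_forall fun k => by simp only [φ]; linarith) hloc
  have hvbd : ∀ k x, ‖fderiv ℝ (v k) x‖ ≤ K := fun k x => by
    rw [hder, convolution_def]
    refine (norm_integral_le_of_norm_le ((φ k).integrable_normed.mul_const (K : ℝ))
      (Eventually.of_forall fun t => ?_)).trans_eq ?_
    · rw [ContinuousLinearMap.lsmul_apply, norm_smul,
        Real.norm_of_nonneg ((φ k).nonneg_normed t)]
      exact mul_le_mul_of_nonneg_left (hbd _) ((φ k).nonneg_normed t)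
    · rw [integral_mul_const, (φ k).integral_normed, one_mul]
  have : ProperSpace (E →L[ℝ] F) := FiniteDimensional.proper ℝ _
  have : ProperSpace E := FiniteDimensional.proper ℝ _
  obtain ⟨M, hM⟩ := (isCompact_closedBall (0 : E →L[ℝ] F) K).exists_bound_of_continuousOn
    hΦ.continuousOn
  set T := Metric.cthickening 1 (tsupport u)
  have hT : IsCompact T := hus.isCompact.cthickening
  have hzero : ∀ k, ∀ x ∉ T, fderiv ℝ (v k) x = 0 := fun k x hx => by
    rw [hder, convolution_def]
    refine integral_eq_zero_of_ae (Eventually.of_forall fun t => ?_)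
    by_cases ht : t ∈ Metric.ball (0 : E) (φ k).rOut
    · have : x - t ∉ tsupport u := fun hm => hx <|
        Metric.mem_cthickening_of_dist_le x (x - t) 1 _ hm <| by
          rw [dist_eq_norm, sub_sub_cancel]
          exact (mem_ball_zero_iff.1 ht).le.trans (hφ1 k)
      simp [fderiv_of_notMem_tsupport ℝ this]
    · have : (φ k).normed ν t = 0 := by
        rw [← Function.notMem_support, (φ k).support_normed_eq]
        exact ht
      simp [this]
  refine tendsto_integral_of_dominated_convergence (T.indicator fun _ => M) (fun k => ?_) ?_
    (fun k => Eventually.of_forall fun x => ?_) ?_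
  · exact (hΦ.comp ((hsm k).continuous_fderiv (by norm_num))).aestronglyMeasurable
  · exact (integrableOn_const hT.measure_lt_top.ne).integrable_indicator hT.measurableSet
  · by_cases hx : x ∈ T
    · rw [Set.indicator_of_mem hx]
      exact hM _ (by simpa using hvbd k x)
    · rw [Set.indicator_of_notMem hx, hzero k x hx, h0, norm_zero]
  · filter_upwards [hae] with x hx
    simp only [hder]
    exact (hΦ.tendsto _).comp hx

end Mollification

theorem exists_integral_gradVec_rpow_le_of_lipschitz {p : ℝ} (hp : 1 < p) :
    ∃ C : ℝ, 0 ≤ C ∧ ∀ (K : NNReal) (u : ℝ × ℝ → ℝ × ℝ), LipschitzWith K u →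
      HasCompactSupport u →
      ∫ y, ‖gradVec (fderiv ℝ u y)‖ ^ p ≤ C * ∫ y, ‖symVec (gradVec (fderiv ℝ u y))‖ ^ p := by
  obtain ⟨C, hC, h⟩ := exists_integral_gradVec_rpow_le_of_contDiff hp
  refine ⟨C, hC, fun K u hu hus => ?_⟩
  obtain ⟨v, hv, hvs, hlim⟩ := hu.exists_contDiff_tendsto_integral_fderiv volume hus
  have hp0 : p ≠ 0 := by linarith
  exact le_of_tendsto_of_tendsto'
    (hlim (fun L => ‖gradVec L‖ ^ p)
      (gradVec.continuous.norm.rpow_const fun _ => Or.inr (by linarith)) (by simp [hp0]))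
    ((hlim (fun L => ‖symVec (gradVec L)‖ ^ p)
      ((symVec.continuous.comp gradVec.continuous).norm.rpow_const
        fun _ => Or.inr (by linarith)) (by simp [hp0])).const_mul C)
    fun k => h (v k) (hv k) (hvs k)

section Strip

open Set

theorem setLIntegral_Ico_prod_of_periodic {f : ℝ × ℝ → ENNReal}
    (hf : ∀ y : ℝ × ℝ, f (y.1 + 1, y.2) = f y) {B : Set ℝ} (hB : MeasurableSet B) (n : ℕ) :
    ∫⁻ y in Ico (-n : ℝ) n ×ˢ B, f y = (2 * n : ℕ) * ∫⁻ y in Ico (0 : ℝ) 1 ×ˢ B, f y := by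
  have hper : ∀ (z : ℤ) (y : ℝ × ℝ), f (y + ((z : ℝ), (0 : ℝ))) = f y := fun z y => by
    have h : Function.Periodic (fun t => f (t, y.2)) 1 := fun t => hf (t, y.2)
    simpa [Prod.add_def] using h.int_mul z y.1
  have hone : ∀ z : ℤ, ∫⁻ y in Ico (z : ℝ) (z + 1) ×ˢ B, f y =
      ∫⁻ y in Ico (0 : ℝ) 1 ×ˢ B, f y := fun z => by
    rw [← (measurePreserving_add_right (volume : Measure (ℝ × ℝ))
      ((z : ℝ), (0 : ℝ))).setLIntegral_comp_preimage_emb (measurableEmbedding_addRight _)]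
    simp only [hper]
    congr 2
    ext y
    simp [add_comm _ (z : ℝ)]
  have hsum : ∀ (a : ℤ) (N : ℕ), ∫⁻ y in Ico (a : ℝ) (a + N) ×ˢ B, f y =
      N * ∫⁻ y in Ico (0 : ℝ) 1 ×ˢ B, f y := fun a N => by
    induction N with
    | zero => simp
    | succ N ih =>
      have h1 : Ico (a : ℝ) (a + (N + 1 : ℕ)) = Ico (a : ℝ) (a + N) ∪ Ico (a + N) (a + N + 1) := by
        rw [Ico_union_Ico_eq_Ico (by simp) (by simp)]
        push_cast
        ring_nf
      have h2 := hone (a + N)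
      push_cast at h2
      rw [h1, union_prod, lintegral_union (measurableSet_Ico.prod hB), ih, h2]
      · push_cast
        ring
      · exact Disjoint.set_prod_left (Ico_disjoint_Ico_same) _ _
  have := hsum (-n) (2 * n)
  push_cast at this ⊢
  rw [← this]
  ring_nf

theorem lintegral_enorm_rpow_gradVec_le_of_lipschitz {p : ℝ} (hp : 1 < p) :
    ∃ C : NNReal, ∀ (K : NNReal) (u : ℝ × ℝ → ℝ × ℝ), LipschitzWith K u →
      HasCompactSupport u →
      ∫⁻ y, ‖gradVec (fderiv ℝ u y)‖ₑ ^ p ≤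
        C * ∫⁻ y, ‖symVec (gradVec (fderiv ℝ u y))‖ₑ ^ p := by
  obtain ⟨C, hC, h⟩ := exists_integral_gradVec_rpow_le_of_lipschitz hp
  have hp0 : 0 < p := by linarith
  refine ⟨C.toNNReal, fun K u hu hus => ?_⟩
  have key : ∀ Φ : (ℝ × ℝ →L[ℝ] ℝ × ℝ) →L[ℝ] EuclideanSpace ℝ (Fin 4),
      ∫⁻ y, ‖Φ (fderiv ℝ u y)‖ₑ ^ p = ENNReal.ofReal (∫ y, ‖Φ (fderiv ℝ u y)‖ ^ p) := fun Φ => by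
    have hm : AEStronglyMeasurable (fun y => ‖Φ (fderiv ℝ u y)‖ ^ p) volume :=
      (Φ.continuous.norm.rpow_const fun _ => Or.inr hp0.le).comp_aestronglyMeasurable
        (aestronglyMeasurable_fderiv volume u)
    have hi : Integrable (fun y => ‖Φ (fderiv ℝ u y)‖ ^ p) := by
      refine (integrableOn_iff_integrable_of_support_subset (s := tsupport u) ?_).1 ?_
      · refine Function.support_subset_iff'.2 fun y hy => ?_
        simp [fderiv_of_notMem_tsupport ℝ hy, hp0.ne']
      · refine Measure.integrableOn_of_bounded hus.measure_lt_top.ne hm (M := (‖Φ‖ * K) ^ p)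
          (Filter.Eventually.of_forall fun y => ?_)
        rw [Real.norm_of_nonneg (by positivity)]
        gcongr
        exact (Φ.le_opNorm _).trans (by gcongr; exact norm_fderiv_le_of_lipschitz ℝ hu)
    rw [ofReal_integral_eq_lintegral_ofReal hi (Filter.Eventually.of_forall fun y => by positivity)]
    refine lintegral_congr fun y => ?_
    rw [← ENNReal.ofReal_rpow_of_nonneg (norm_nonneg _) hp0.le, ofReal_norm]
  have hg := key gradVec
  have hs := key (symVec.comp gradVec)
  simp only [ContinuousLinearMap.comp_apply] at hs
  rw [hg, hs, ← ENNReal.ofReal_coe_nnreal, Real.coe_toNNReal C hC, ← ENNReal.ofReal_mul hC]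
  exact ENNReal.ofReal_le_ofReal (h K u hu hus)

end Strip

section Decay

open Set Filter Topology

theorem LipschitzWith.enorm_sub_le_lintegral_enorm_deriv {f : ℝ → ℝ × ℝ} {K : NNReal}
    (hf : LipschitzWith K f) {a b : ℝ} (hab : a ≤ b) :
    ‖f b - f a‖ₑ ≤ ∫⁻ t in Ioc a b, ‖deriv f t‖ₑ := by
  have key : ∀ ℓ : ℝ × ℝ →L[ℝ] ℝ, ‖ℓ (f b) - ℓ (f a)‖ₑ ≤ ∫⁻ t in Ioc a b, ‖ℓ (deriv f t)‖ₑ :=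
      fun ℓ => by
    have hac : AbsolutelyContinuousOnInterval (fun t => ℓ (f t)) a b :=
      ((ℓ.lipschitz.comp hf).lipschitzOnWith (s := uIcc a b)).absolutelyContinuousOnInterval
    have hd : ∀ᵐ t, deriv (fun t => ℓ (f t)) t = ℓ (deriv f t) := by
      filter_upwards [hf.ae_differentiableAt (μ := volume)] with t ht
      exact (ℓ.hasFDerivAt.comp_hasDerivAt t ht.hasDerivAt).deriv
    rw [← hac.integral_deriv_eq_sub, intervalIntegral.integral_of_le hab]
    refine (enorm_integral_le_lintegral_enorm _).trans_eq (lintegral_congr_ae ?_)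
    filter_upwards [ae_restrict_of_ae hd] with t ht
    rw [ht]
  have hmax : ∀ x : ℝ × ℝ, ‖x‖ₑ = max ‖x.1‖ₑ ‖x.2‖ₑ := fun x => by
    simp only [← ofReal_norm, Prod.norm_def, ENNReal.ofReal_max]
  simp only [hmax]
  refine max_le ((key (ContinuousLinearMap.fst ℝ ℝ ℝ)).trans ?_)
    ((key (ContinuousLinearMap.snd ℝ ℝ ℝ)).trans ?_)
  · exact lintegral_mono fun t => le_max_left _ _
  · exact lintegral_mono fun t => le_max_right _ _

/-- Jensen's inequality on a set of finite measure. -/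
theorem rpow_setLIntegral_le {α : Type*} [MeasurableSpace α] {μ : Measure α} {p : ℝ} (hp : 1 < p)
    {f : α → ENNReal} (hf : AEMeasurable f μ) (s : Set α) :
    (∫⁻ t in s, f t ∂μ) ^ p ≤ μ s ^ (p - 1) * ∫⁻ t in s, f t ^ p ∂μ := by
  have hp0 : 0 < p := by linarith
  have h := ENNReal.lintegral_mul_le_Lp_mul_Lq (μ.restrict s)
    (Real.HolderConjugate.conjExponent hp) hf.restrict (aemeasurable_const (b := 1))
  simp only [Pi.mul_apply, mul_one, ENNReal.one_rpow, lintegral_const, one_mul,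
    Measure.restrict_apply_univ] at h
  calc (∫⁻ t in s, f t ∂μ) ^ p
      ≤ ((∫⁻ t in s, f t ^ p ∂μ) ^ (1 / p) * μ s ^ (1 / p.conjExponent)) ^ p := by gcongr
    _ = μ s ^ (p - 1) * ∫⁻ t in s, f t ^ p ∂μ := by
      rw [ENNReal.mul_rpow_of_nonneg _ _ hp0.le, ← ENNReal.rpow_mul, ← ENNReal.rpow_mul,
        one_div_mul_cancel hp0.ne', ENNReal.rpow_one, mul_comm]
      congr 2
      rw [Real.conjExponent]
      field_simp

theorem enorm_rpow_le_of_eq_zero_below {p : ℝ} (hp : 1 < p) {f : ℝ → ℝ × ℝ} {K : NNReal}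
    (hf : LipschitzWith K f) (h0 : ∀ t ≤ -1, f t = 0) {R M t : ℝ} (hR : 0 ≤ R) (ht : t ≤ M) :
    ‖f t‖ₑ ^ p ≤ 2 ^ (p - 1) * (ENNReal.ofReal (K * (R + 1)) ^ p +
      ENNReal.ofReal M ^ (p - 1) * ∫⁻ s in Ioi R, ‖deriv f s‖ₑ ^ p) := by
  have hp0 : 0 < p := by linarith
  have h1 : ‖f (min t R)‖ₑ ≤ ENNReal.ofReal (K * (R + 1)) := by
    rw [← ofReal_norm]
    refine ENNReal.ofReal_le_ofReal ?_
    rcases le_total (min t R) (-1) with h | h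
    · rw [h0 _ h, norm_zero]
      positivity
    · have := hf.dist_le_mul (min t R) (-1)
      rw [h0 (-1) le_rfl, dist_zero_right, Real.dist_eq, abs_of_nonneg (by linarith)] at this
      refine this.trans ?_
      gcongr
      linarith [min_le_right t R]
  have h2 : ‖f t - f (min t R)‖ₑ ≤ ∫⁻ s in Ioc R M, ‖deriv f s‖ₑ := by
    refine (hf.enorm_sub_le_lintegral_enorm_deriv (min_le_left t R)).trans
      (lintegral_mono_set fun s hs => ⟨?_, hs.2.trans ht⟩)
    rcases le_total t R with h | h
    · rw [min_eq_left h] at hs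
      exact absurd hs.2 hs.1.not_ge
    · rw [min_eq_right h] at hs
      exact hs.1
  have h3 : (∫⁻ s in Ioc R M, ‖deriv f s‖ₑ) ^ p ≤
      ENNReal.ofReal M ^ (p - 1) * ∫⁻ s in Ioi R, ‖deriv f s‖ₑ ^ p := by
    refine (rpow_setLIntegral_le hp (measurable_deriv f).enorm.aemeasurable _).trans ?_
    rw [Real.volume_Ioc]
    gcongr
    · linarith
    · exact Ioc_subset_Ioi_self
  calc ‖f t‖ₑ ^ p = ‖f (min t R) + (f t - f (min t R))‖ₑ ^ p := by rw [add_sub_cancel]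
    _ ≤ (‖f (min t R)‖ₑ + ‖f t - f (min t R)‖ₑ) ^ p := by
      gcongr
      exact enorm_add_le _ _
    _ ≤ 2 ^ (p - 1) * (‖f (min t R)‖ₑ ^ p + ‖f t - f (min t R)‖ₑ ^ p) :=
      ENNReal.rpow_add_le_mul_rpow_add_rpow _ _ hp.le
    _ ≤ _ := by
      gcongr
      exact (ENNReal.rpow_le_rpow h2 hp0.le).trans h3

theorem setLIntegral_enorm_rpow_le_of_eq_zero_below {p : ℝ} (hp : 1 < p) {u : ℝ × ℝ → ℝ × ℝ}
    {K : NNReal} (hu : LipschitzWith K u) (h0 : ∀ y : ℝ × ℝ, y.2 ≤ -1 → u y = 0) {R : ℝ}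
    (hR : 0 ≤ R) (M : ℝ) :
    ∫⁻ y in Ico (0 : ℝ) 1 ×ˢ Icc (-M) M, ‖u y‖ₑ ^ p ≤
      2 ^ p * ENNReal.ofReal M * (ENNReal.ofReal (K * (R + 1)) ^ p + ENNReal.ofReal M ^ (p - 1) *
        ∫⁻ y in Ico (0 : ℝ) 1 ×ˢ Ioi R, ‖fderiv ℝ u y‖ₑ ^ p) := by
  have hd : ∀ᵐ x : ℝ, ∀ᵐ t : ℝ, DifferentiableAt ℝ u (x, t) :=
    Measure.ae_ae_of_ae_prod (hu.ae_differentiableAt (μ := (volume : Measure (ℝ × ℝ))))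
  have hm : Measurable fun y => ‖fderiv ℝ u y‖ₑ ^ p := (measurable_fderiv ℝ u).enorm.pow_const p
  have hslice : ∀ᵐ x : ℝ, ∫⁻ t in Icc (-M) M, ‖u (x, t)‖ₑ ^ p ≤
      2 ^ p * ENNReal.ofReal M * (ENNReal.ofReal (K * (R + 1)) ^ p + ENNReal.ofReal M ^ (p - 1) *
        ∫⁻ t in Ioi R, ‖fderiv ℝ u (x, t)‖ₑ ^ p) := by
    filter_upwards [hd] with x hx
    have hlip : LipschitzWith K fun t => u (x, t) := by
      simpa [Function.comp_def] using hu.comp (LipschitzWith.prodMk_left x)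
    have hder : ∫⁻ t in Ioi R, ‖deriv (fun t => u (x, t)) t‖ₑ ^ p ≤
        ∫⁻ t in Ioi R, ‖fderiv ℝ u (x, t)‖ₑ ^ p := by
      refine lintegral_mono_ae ?_
      filter_upwards [ae_restrict_of_ae hx] with t ht
      have h1 : deriv (fun t => u (x, t)) t = fderiv ℝ u (x, t) (0, 1) :=
        (ht.hasFDerivAt.comp_hasDerivAt t ((hasDerivAt_const t x).prodMk (hasDerivAt_id t))).deriv
      rw [h1]
      refine ENNReal.rpow_le_rpow ?_ (by linarith)
      refine (ContinuousLinearMap.le_opENorm _ _).trans_eq ?_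
      simp [← ofReal_norm, Prod.norm_def]
    calc ∫⁻ t in Icc (-M) M, ‖u (x, t)‖ₑ ^ p
        ≤ ∫⁻ _ in Icc (-M) M, 2 ^ (p - 1) * (ENNReal.ofReal (K * (R + 1)) ^ p +
          ENNReal.ofReal M ^ (p - 1) * ∫⁻ t in Ioi R, ‖fderiv ℝ u (x, t)‖ₑ ^ p) := by
          refine setLIntegral_mono measurable_const fun t ht => ?_
          refine (enorm_rpow_le_of_eq_zero_below hp hlip (fun t ht => h0 (x, t) ht) hR
            ht.2).trans ?_
          gcongr
      _ = _ := by
          rw [setLIntegral_const, Real.volume_Icc, sub_neg_eq_add, ← two_mul,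
            ENNReal.ofReal_mul (p := 2) (by norm_num), ENNReal.ofReal_ofNat]
          have : (2 : ENNReal) ^ p = 2 ^ (p - 1) * 2 := by
            conv_rhs => rw [← ENNReal.rpow_one 2, ← ENNReal.rpow_mul, one_mul,
              ← ENNReal.rpow_add _ _ (by norm_num) (by norm_num), sub_add_cancel]
          rw [this]
          ring
  rw [Measure.volume_eq_prod, setLIntegral_prod, setLIntegral_prod _ hm.aemeasurable]
  · refine (lintegral_mono_ae (ae_restrict_of_ae hslice)).trans_eq ?_
    have hm' : Measurable fun x => ∫⁻ t in Ioi R, ‖fderiv ℝ u (x, t)‖ₑ ^ p := hm.lintegral_prod_right'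
    rw [lintegral_const_mul _ (by fun_prop), lintegral_add_left (by fun_prop),
      lintegral_const_mul _ hm']
    simp
  · exact (hu.continuous.measurable.enorm.pow_const p).aemeasurable

theorem tendsto_rpow_neg_mul_setLIntegral_enorm_rpow {p : ℝ} (hp : 1 < p) {u : ℝ × ℝ → ℝ × ℝ}
    {K : NNReal} (hu : LipschitzWith K u) (h0 : ∀ y : ℝ × ℝ, y.2 ≤ -1 → u y = 0)
    (hfin : ∫⁻ y in Ico (0 : ℝ) 1 ×ˢ univ, ‖fderiv ℝ u y‖ₑ ^ p ≠ ⊤) :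
    Tendsto (fun n : ℕ => (n : ENNReal) ^ (-p) *
      ∫⁻ y in Ico (0 : ℝ) 1 ×ˢ Icc (-(3 * n) : ℝ) (3 * n), ‖u y‖ₑ ^ p) atTop (𝓝 0) := by
  have hp0 : 0 < p := by linarith
  set T : ℕ → ENNReal := fun k => ∫⁻ y in Ico (0 : ℝ) 1 ×ˢ Ioi (k : ℝ), ‖fderiv ℝ u y‖ₑ ^ p
  have hT : Tendsto T atTop (𝓝 0) := by
    set μ := volume.withDensity fun y => ‖fderiv ℝ u y‖ₑ ^ p
    have hms : ∀ k : ℕ, MeasurableSet (Ico (0 : ℝ) 1 ×ˢ Ioi (k : ℝ)) := fun k =>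
      measurableSet_Ico.prod measurableSet_Ioi
    have hμ : ∀ k, T k = μ (Ico (0 : ℝ) 1 ×ˢ Ioi (k : ℝ)) := fun k =>
      (withDensity_apply _ (hms k)).symm
    rw [funext hμ]
    have hempty : ⋂ k : ℕ, Ico (0 : ℝ) 1 ×ˢ Ioi (k : ℝ) = ∅ := by
      refine eq_empty_of_forall_notMem fun y hy => ?_
      obtain ⟨k, hk⟩ := exists_nat_ge y.2
      exact (mem_iInter.1 hy k).2.not_ge hk
    rw [← measure_empty (μ := μ), ← hempty]
    refine tendsto_measure_iInter_atTop (fun k => (hms k).nullMeasurableSet)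
      (fun k l hkl => prod_mono_right (Ioi_subset_Ioi (by exact_mod_cast hkl))) ⟨0, ?_⟩
    rw [← hμ]
    exact ((lintegral_mono_set (prod_mono_right (subset_univ _))).trans_lt hfin.lt_top).ne
  have hbound : ∀ k n : ℕ, 0 < n → (n : ENNReal) ^ (-p) *
      ∫⁻ y in Ico (0 : ℝ) 1 ×ˢ Icc (-(3 * n) : ℝ) (3 * n), ‖u y‖ₑ ^ p ≤
      2 ^ p * 3 * ENNReal.ofReal (K * (k + 1)) ^ p * (n : ENNReal) ^ (1 - p) +
        2 ^ p * 3 * 3 ^ (p - 1) * T k := fun k n hn => by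
    have h := setLIntegral_enorm_rpow_le_of_eq_zero_below hp hu h0 k.cast_nonneg (3 * n)
    have hM : ENNReal.ofReal (3 * n) = 3 * n := by
      rw [ENNReal.ofReal_mul (by norm_num)]
      simp
    rw [hM] at h
    have hn0 : (n : ENNReal) ≠ 0 := by exact_mod_cast hn.ne'
    have hn1 : (n : ENNReal) ≠ ⊤ := ENNReal.natCast_ne_top n
    have e1 : (n : ENNReal) ^ (-p) * n = (n : ENNReal) ^ (1 - p) := by
      conv_lhs => rw [← ENNReal.rpow_one (n : ENNReal), ← ENNReal.rpow_mul, one_mul,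
        ← ENNReal.rpow_add _ _ hn0 hn1]
      ring_nf
    have e2 : (n : ENNReal) ^ (1 - p) * (n : ENNReal) ^ (p - 1) = 1 := by
      rw [← ENNReal.rpow_add _ _ hn0 hn1]
      simp
    refine (mul_le_mul_right h _).trans_eq ?_
    rw [ENNReal.mul_rpow_of_nonneg _ _ (by linarith : (0 : ℝ) ≤ p - 1)]
    calc _ = 2 ^ p * 3 * ENNReal.ofReal (K * (k + 1)) ^ p * ((n : ENNReal) ^ (-p) * n) +
        2 ^ p * 3 * 3 ^ (p - 1) * T k * (((n : ENNReal) ^ (-p) * n) * (n : ENNReal) ^ (p - 1)) := by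
          ring
      _ = _ := by rw [e1, e2, mul_one]
  rw [ENNReal.tendsto_nhds_zero]
  intro ε hε
  have hε2 : 0 < ε / 2 := ENNReal.half_pos hε.ne'
  have hlim : Tendsto (fun k => 2 ^ p * 3 * 3 ^ (p - 1) * T k) atTop (𝓝 0) := by
    have hc : (2 : ENNReal) ^ p * 3 * 3 ^ (p - 1) ≠ ⊤ := by finiteness
    simpa using ENNReal.Tendsto.const_mul hT (Or.inr hc)
  obtain ⟨k, hk⟩ := ((ENNReal.tendsto_nhds_zero.1 hlim) (ε / 2) hε2).exists
  have hlim' : Tendsto (fun n : ℕ => 2 ^ p * 3 * ENNReal.ofReal (K * (k + 1)) ^ p *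
      (n : ENNReal) ^ (1 - p)) atTop (𝓝 0) := by
    have hc : (2 : ENNReal) ^ p * 3 * ENNReal.ofReal (K * (k + 1)) ^ p ≠ ⊤ := by finiteness
    have hn : Tendsto (fun n : ℕ => (n : ENNReal) ^ (1 - p)) atTop (𝓝 0) := by
      have := (ENNReal.continuous_rpow_const (y := 1 - p)).continuousAt.tendsto.comp
        ENNReal.tendsto_nat_nhds_top
      rwa [ENNReal.top_rpow_of_neg (by linarith)] at this
    simpa using ENNReal.Tendsto.const_mul hn (Or.inr hc)
  filter_upwards [ENNReal.tendsto_nhds_zero.1 hlim' (ε / 2) hε2, eventually_gt_atTop 0] with n hn h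
  exact (hbound k n h).trans ((add_le_add hn hk).trans_eq (ENNReal.add_halves ε))

end Decay

section Cutoff

open Set Filter Topology

theorem LipschitzWith.exists_smul_of_hasCompactSupport {E F : Type*} [PseudoMetricSpace E]
    [NormedAddCommGroup F] [NormedSpace ℝ F] {χ : E → ℝ} {u : E → F} {c K : NNReal}
    (hχ : LipschitzWith c χ) (hχs : HasCompactSupport χ) (hχ1 : ∀ x, ‖χ x‖ ≤ 1)
    (hu : LipschitzWith K u) : ∃ K' : NNReal, LipschitzWith K' fun x => χ x • u x := by
  obtain ⟨M, hM⟩ := hχs.exists_bound_of_continuousOn (f := u) hu.continuous.continuousOn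
  have hM' : ∀ x, χ x ≠ 0 → ‖u x‖ ≤ |M| := fun x hx =>
    (hM x (subset_tsupport χ hx)).trans (le_abs_self M)
  have key : ∀ x z, χ z ≠ 0 → dist (χ x • u x) (χ z • u z) ≤ (K + c * |M|) * dist x z :=
      fun x z hz => by
    have h : χ x • u x - χ z • u z = χ x • (u x - u z) + (χ x - χ z) • u z := by
      rw [smul_sub, sub_smul]
      abel
    rw [dist_eq_norm, h]
    refine (norm_add_le _ _).trans ?_
    rw [norm_smul, norm_smul, ← dist_eq_norm, ← dist_eq_norm]
    calc ‖χ x‖ * dist (u x) (u z) + dist (χ x) (χ z) * ‖u z‖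
        ≤ 1 * (K * dist x z) + (c * dist x z) * |M| := by
          gcongr
          exacts [hχ1 x, hu.dist_le_mul x z, hχ.dist_le_mul x z, hM' z hz]
      _ = _ := by ring
  refine ⟨K + c * Real.nnabs M, LipschitzWith.of_dist_le_mul fun x z => ?_⟩
  push_cast
  by_cases hz : χ z = 0
  · by_cases hx : χ x = 0
    · simp only [hx, hz, zero_smul, dist_self]
      positivity
    · rw [dist_comm, dist_comm x z]
      exact key z x hx
  · exact key x z hz

/-- Smooth cutoff functions at scale `r`, whose gradient is of order `1 / r`. -/
theorem exists_cutoff (E : Type*) [NormedAddCommGroup E] [NormedSpace ℝ E]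
    [FiniteDimensional ℝ E] :
    ∃ c : NNReal, ∀ r : NNReal, 0 < r → ∃ χ : E → ℝ, ContDiff ℝ 1 χ ∧
      (∀ y, ‖χ y‖ ≤ 1) ∧ (∀ y ∈ Metric.ball (0 : E) (2 * r), χ y = 1) ∧
      tsupport χ ⊆ Metric.closedBall 0 (3 * r) ∧ ∀ y, ‖fderiv ℝ χ y‖ ≤ c / r := by
  let θ : ContDiffBump (0 : E) := ⟨2, 3, by norm_num, by norm_num⟩
  have hθ : ContDiff ℝ 1 θ := θ.contDiff
  obtain ⟨c, hc⟩ := (hθ.continuous_fderiv one_ne_zero).bounded_above_of_compact_support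
    (θ.hasCompactSupport.fderiv ℝ)
  refine ⟨c.toNNReal, fun r hr => ⟨fun y => θ ((r : ℝ)⁻¹ • y), hθ.comp (contDiff_const_smul _),
    fun y => ?_, fun y hy => ?_, ?_, fun y => ?_⟩⟩
  · rw [Real.norm_of_nonneg θ.nonneg]
    exact θ.le_one
  · refine θ.one_of_mem_closedBall ?_
    rw [mem_ball_zero_iff] at hy
    rw [mem_closedBall_zero_iff, norm_smul, norm_inv, NNReal.norm_eq, inv_mul_le_iff₀ (by simpa)]
    linarith
  · refine closure_minimal (fun y hy => ?_) Metric.isClosed_closedBall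
    have h : (r : ℝ)⁻¹ • y ∈ Function.support θ := hy
    rw [θ.support_eq, mem_ball_zero_iff, norm_smul, norm_inv, NNReal.norm_eq,
      inv_mul_lt_iff₀ (by simpa)] at h
    rw [mem_closedBall_zero_iff]
    linarith
  · rw [fderiv_comp_smul, norm_smul, norm_inv, NNReal.norm_eq, inv_mul_eq_div]
    gcongr
    exact (hc _).trans (Real.le_coe_toNNReal c)

theorem ae_fderiv_smul_eq {E F : Type*} [NormedAddCommGroup E] [NormedSpace ℝ E]
    [FiniteDimensional ℝ E] [MeasurableSpace E] [BorelSpace E] (ν : Measure E)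
    [ν.IsAddHaarMeasure] [NormedAddCommGroup F] [NormedSpace ℝ F] [FiniteDimensional ℝ F]
    {χ : E → ℝ} {u : E → F} {K : NNReal} (hχ : Differentiable ℝ χ) (hu : LipschitzWith K u) :
    ∀ᵐ y ∂ν, fderiv ℝ (fun y => χ y • u y) y =
      χ y • fderiv ℝ u y + (fderiv ℝ χ y).smulRight (u y) := by
  filter_upwards [hu.ae_differentiableAt (μ := ν)] with y hy
  exact fderiv_fun_smul (hχ y) hy

end Cutoff

section Korn

open Set Filter Topology

theorem exists_nnreal_enorm_le_enorm_gradVec :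
    ∃ c : NNReal, ∀ L : ℝ × ℝ →L[ℝ] ℝ × ℝ, ‖L‖ₑ ≤ c * ‖gradVec L‖ₑ := by
  have hinj : LinearMap.ker gradVec.toLinearMap = ⊥ := by
    refine LinearMap.ker_eq_bot'.2 fun L hL => ?_
    have h : gradVec L = 0 := hL
    have h0 : (L (1, 0)).1 = 0 := by simpa [gradVec_apply] using congrArg (fun v => v 0) h
    have h1 : (L (0, 1)).1 = 0 := by simpa [gradVec_apply] using congrArg (fun v => v 1) h
    have h2 : (L (1, 0)).2 = 0 := by simpa [gradVec_apply] using congrArg (fun v => v 2) h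
    have h3 : (L (0, 1)).2 = 0 := by simpa [gradVec_apply] using congrArg (fun v => v 3) h
    ext <;> simp [h0, h1, h2, h3]
  obtain ⟨c, -, hc⟩ := gradVec.toLinearMap.exists_antilipschitzWith hinj
  refine ⟨c, fun L => ?_⟩
  simpa [edist_zero_right] using hc L 0

theorem setLIntegral_gradVec_rpow_le_of_cutoff {p : ℝ} (hp : 1 < p) :
    ∃ C a : NNReal, ∀ (K : NNReal) (u : ℝ × ℝ → ℝ × ℝ), LipschitzWith K u →
      (∀ y : ℝ × ℝ, u (y.1 + 1, y.2) = u y) → ∀ n : ℕ, 0 < n →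
      ∫⁻ y in Ico (0 : ℝ) 1 ×ˢ Ioo (-n : ℝ) n, ‖gradVec (fderiv ℝ u y)‖ₑ ^ p ≤
        C * ((∫⁻ y in Ico (0 : ℝ) 1 ×ˢ univ, ‖symVec (gradVec (fderiv ℝ u y))‖ₑ ^ p) +
          a * ((n : ENNReal) ^ (-p) *
            ∫⁻ y in Ico (0 : ℝ) 1 ×ˢ Icc (-(3 * n) : ℝ) (3 * n), ‖u y‖ₑ ^ p)) := by
  have hp0 : 0 < p := by linarith
  obtain ⟨C, hC⟩ := lintegral_enorm_rpow_gradVec_le_of_lipschitz hp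
  obtain ⟨c, hc⟩ := exists_cutoff (ℝ × ℝ)
  set b : NNReal := ‖symVec.comp gradVec‖₊ * c
  refine ⟨C * 4 * 2 ^ (p - 1), b ^ p, fun K u hu hper n hn => ?_⟩
  have hn0 : (n : ENNReal) ≠ 0 := by exact_mod_cast hn.ne'
  have hn1 : (n : ENNReal) ≠ ⊤ := ENNReal.natCast_ne_top n
  have hnr : (0 : ℝ) < n := by exact_mod_cast hn
  obtain ⟨χ, hχ, hχ1, hχe, hχs, hχd⟩ := hc n (by exact_mod_cast hn)
  rw [NNReal.coe_natCast] at hχe hχs hχd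
  have hχc : HasCompactSupport χ := (isCompact_closedBall _ _).of_isClosed_subset
    (isClosed_tsupport χ) hχs
  have hχl : LipschitzWith (c / n) χ :=
    lipschitzWith_of_nnnorm_fderiv_le (hχ.differentiable one_ne_zero) fun y => by
      exact_mod_cast hχd y
  obtain ⟨K', hv⟩ := hχl.exists_smul_of_hasCompactSupport hχc hχ1 hu
  have hmain := hC K' _ hv hχc.smul_right
  have hfper : ∀ y : ℝ × ℝ, fderiv ℝ u (y.1 + 1, y.2) = fderiv ℝ u y := fun y => by
    have h1 : (fun z : ℝ × ℝ => u (z + ((1 : ℝ), (0 : ℝ)))) = u := funext fun z => by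
      simpa [Prod.add_def] using hper z
    have h2 := fderiv_comp_add_right (𝕜 := ℝ) (f := u) (x := y) ((1 : ℝ), (0 : ℝ))
    rw [h1] at h2
    simpa [Prod.add_def] using h2.symm
  have hlow : (2 * n : ℕ) * ∫⁻ y in Ico (0 : ℝ) 1 ×ˢ Ioo (-n : ℝ) n,
      ‖gradVec (fderiv ℝ u y)‖ₑ ^ p ≤
      ∫⁻ y, ‖gradVec (fderiv ℝ (fun y => χ y • u y) y)‖ₑ ^ p := by
    rw [← setLIntegral_Ico_prod_of_periodic (fun y => by rw [hfper y]) measurableSet_Ioo n]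
    refine (setLIntegral_congr_fun (measurableSet_Ico.prod measurableSet_Ioo)
      fun y hy => ?_).trans_le (setLIntegral_le_lintegral _ _)
    have hy' : y ∈ Metric.ball (0 : ℝ × ℝ) (2 * n) := by
      rw [mem_ball_zero_iff, Prod.norm_def, Real.norm_eq_abs, Real.norm_eq_abs, max_lt_iff,
        abs_lt, abs_lt]
      obtain ⟨⟨h1, h2⟩, h3, h4⟩ := hy
      constructor <;> constructor <;> linarith
    have he : (fun y => χ y • u y) =ᶠ[𝓝 y] u := by
      filter_upwards [Metric.isOpen_ball.mem_nhds hy'] with z hz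
      rw [hχe z hz, one_smul]
    simp only [he.fderiv_eq]
  have hup : ∫⁻ y, ‖symVec (gradVec (fderiv ℝ (fun y => χ y • u y) y))‖ₑ ^ p ≤
      (2 * (4 * n : ℕ) : ℕ) * ∫⁻ y in Ico (0 : ℝ) 1 ×ˢ Icc (-(3 * n) : ℝ) (3 * n), 2 ^ (p - 1) *
        (‖symVec (gradVec (fderiv ℝ u y))‖ₑ ^ p +
          (b : ENNReal) ^ p * (n : ENNReal) ^ (-p) * ‖u y‖ₑ ^ p) := by
    have hms : MeasurableSet (Ico (-(4 * n : ℕ) : ℝ) (4 * n : ℕ) ×ˢ Icc (-(3 * n) : ℝ) (3 * n)) :=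
      measurableSet_Ico.prod measurableSet_Icc
    rw [← setLIntegral_Ico_prod_of_periodic (fun y => by rw [hfper y, hper y])
      measurableSet_Icc (4 * n), ← lintegral_indicator hms]
    refine lintegral_mono_ae ?_
    filter_upwards [ae_fderiv_smul_eq volume (hχ.differentiable one_ne_zero) hu] with y hy
    by_cases hys : y ∈ tsupport χ
    · have hyb := hχs hys
      rw [mem_closedBall_zero_iff, Prod.norm_def, Real.norm_eq_abs, Real.norm_eq_abs,
        max_le_iff, abs_le, abs_le] at hyb
      rw [indicator_of_mem]
      · have h1 : ‖symVec (gradVec (fderiv ℝ (fun y => χ y • u y) y))‖ₑ ≤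
            ‖symVec (gradVec (fderiv ℝ u y))‖ₑ + b * (n : ENNReal)⁻¹ * ‖u y‖ₑ := by
          rw [hy, map_add, map_add, map_smul, map_smul]
          refine (enorm_add_le _ _).trans (add_le_add ?_ ?_)
          · rw [enorm_smul]
            refine mul_le_of_le_one_left' ?_
            rw [← ofReal_norm]
            exact ENNReal.ofReal_le_one.2 (hχ1 y)
          · have h2 : ‖symVec (gradVec ((fderiv ℝ χ y).smulRight (u y)))‖₊ ≤
                b * (n : NNReal)⁻¹ * ‖u y‖₊ := by
              have h3 := (symVec.comp gradVec).le_opNNNorm ((fderiv ℝ χ y).smulRight (u y))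
              rw [ContinuousLinearMap.nnnorm_smulRight_apply] at h3
              refine h3.trans ?_
              have h4 : ‖fderiv ℝ χ y‖₊ ≤ c / n := by exact_mod_cast hχd y
              calc _ ≤ ‖symVec.comp gradVec‖₊ * (c / n * ‖u y‖₊) := by gcongr
                _ = _ := by
                  rw [div_eq_mul_inv]
                  ring
            have h5 : ((n : NNReal)⁻¹ : NNReal) = (n : ENNReal)⁻¹ := by
              rw [ENNReal.coe_inv (by exact_mod_cast hn.ne'), ENNReal.coe_natCast]
            simp only [enorm_eq_nnnorm]
            rw [← h5]
            exact_mod_cast h2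
        refine (ENNReal.rpow_le_rpow h1 hp0.le).trans
          ((ENNReal.rpow_add_le_mul_rpow_add_rpow _ _ hp.le).trans_eq ?_)
        rw [ENNReal.mul_rpow_of_nonneg _ _ hp0.le, ENNReal.mul_rpow_of_nonneg _ _ hp0.le,
          ENNReal.inv_rpow, ENNReal.rpow_neg]
      · push_cast
        refine ⟨⟨?_, ?_⟩, hyb.2⟩ <;> linarith [hyb.1.1, hyb.1.2]
    · have h0 : fderiv ℝ (fun y => χ y • u y) y = 0 :=
        fderiv_of_notMem_tsupport ℝ fun h => hys (tsupport_smul_subset_left χ u h)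
      simp [h0, hp0]
  have hsplit : ∫⁻ y in Ico (0 : ℝ) 1 ×ˢ Icc (-(3 * n) : ℝ) (3 * n), 2 ^ (p - 1) *
        (‖symVec (gradVec (fderiv ℝ u y))‖ₑ ^ p +
          (b : ENNReal) ^ p * (n : ENNReal) ^ (-p) * ‖u y‖ₑ ^ p) ≤
      2 ^ (p - 1) * ((∫⁻ y in Ico (0 : ℝ) 1 ×ˢ univ, ‖symVec (gradVec (fderiv ℝ u y))‖ₑ ^ p) +
        (b : ENNReal) ^ p * ((n : ENNReal) ^ (-p) *
          ∫⁻ y in Ico (0 : ℝ) 1 ×ˢ Icc (-(3 * n) : ℝ) (3 * n), ‖u y‖ₑ ^ p)) := by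
    have hmu : Measurable fun y => ‖u y‖ₑ ^ p := hu.continuous.measurable.enorm.pow_const p
    rw [lintegral_const_mul' _ _ (by finiteness), lintegral_add_right _ (hmu.const_mul _),
      lintegral_const_mul _ hmu, mul_assoc]
    gcongr
    exact subset_univ _
  have h2n0 : ((2 * n : ℕ) : ENNReal) ≠ 0 := by exact_mod_cast (by positivity : 2 * n ≠ 0)
  rw [← ENNReal.mul_le_mul_iff_right h2n0 (ENNReal.natCast_ne_top _)]
  refine (hlow.trans (hmain.trans (mul_le_mul_right (hup.trans (mul_le_mul_right hsplit _))
    _))).trans_eq ?_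
  clear_value b
  have hb : ((b ^ p : NNReal) : ENNReal) = (b : ENNReal) ^ p := ENNReal.coe_rpow_of_nonneg _ hp0.le
  have h2 : (((2 : NNReal) ^ (p - 1) : NNReal) : ENNReal) = 2 ^ (p - 1) :=
    ENNReal.coe_rpow_of_nonneg _ (by linarith)
  rw [ENNReal.coe_mul, ENNReal.coe_mul, hb, h2]
  push_cast
  ring

theorem exists_setLIntegral_strip_gradVec_rpow_le {p : ℝ} (hp : 1 < p) :
    ∃ C : NNReal, ∀ (K : NNReal) (u : ℝ × ℝ → ℝ × ℝ), LipschitzWith K u →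
      (∀ y : ℝ × ℝ, u (y.1 + 1, y.2) = u y) → (∀ y : ℝ × ℝ, y.2 ≤ -1 → u y = 0) →
      ∫⁻ y in Ico (0 : ℝ) 1 ×ˢ univ, ‖gradVec (fderiv ℝ u y)‖ₑ ^ p ≠ ⊤ →
      ∫⁻ y in Ico (0 : ℝ) 1 ×ˢ univ, ‖gradVec (fderiv ℝ u y)‖ₑ ^ p ≤
        C * ∫⁻ y in Ico (0 : ℝ) 1 ×ˢ univ, ‖symVec (gradVec (fderiv ℝ u y))‖ₑ ^ p := by
  have hp0 : 0 < p := by linarith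
  obtain ⟨C, a, h⟩ := setLIntegral_gradVec_rpow_le_of_cutoff hp
  obtain ⟨c, hc⟩ := exists_nnreal_enorm_le_enorm_gradVec
  refine ⟨C, fun K u hu hper h0 hfin => ?_⟩
  have hfin' : ∫⁻ y in Ico (0 : ℝ) 1 ×ˢ univ, ‖fderiv ℝ u y‖ₑ ^ p ≠ ⊤ := by
    refine ne_top_of_le_ne_top (b := (c : ENNReal) ^ p * ∫⁻ y in Ico (0 : ℝ) 1 ×ˢ univ,
      ‖gradVec (fderiv ℝ u y)‖ₑ ^ p) (by finiteness) ?_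
    rw [← lintegral_const_mul' _ _ (by finiteness)]
    refine lintegral_mono fun y => ?_
    rw [← ENNReal.mul_rpow_of_nonneg _ _ hp0.le]
    exact ENNReal.rpow_le_rpow (hc _) hp0.le
  have herr := tendsto_rpow_neg_mul_setLIntegral_enorm_rpow hp hu h0 hfin'
  have hlim := ENNReal.Tendsto.const_mul (a := (C : ENNReal)) ((ENNReal.Tendsto.const_mul
    (a := (a : ENNReal)) herr (Or.inr ENNReal.coe_ne_top)).const_add
    (∫⁻ y in Ico (0 : ℝ) 1 ×ˢ univ, ‖symVec (gradVec (fderiv ℝ u y))‖ₑ ^ p))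
    (Or.inr ENNReal.coe_ne_top)
  rw [mul_zero, add_zero] at hlim
  have hmono : Monotone fun n : ℕ => Ico (0 : ℝ) 1 ×ˢ Ioo (-n : ℝ) n := fun m n hmn => by
    have : (m : ℝ) ≤ n := by exact_mod_cast hmn
    exact prod_mono_right (Ioo_subset_Ioo (by linarith) this)
  have hU : Ico (0 : ℝ) 1 ×ˢ (univ : Set ℝ) = ⋃ n : ℕ, Ico (0 : ℝ) 1 ×ˢ Ioo (-n : ℝ) n := by
    rw [← prod_iUnion]
    congr 1
    refine (eq_univ_of_forall fun t => ?_).symm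
    obtain ⟨n, hn⟩ := exists_nat_gt |t|
    exact mem_iUnion.2 ⟨n, abs_lt.1 hn⟩
  conv_lhs => rw [hU, setLIntegral_iUnion_of_directed _ hmono.directed_le]
  refine iSup_le fun m => ge_of_tendsto hlim ?_
  filter_upwards [eventually_ge_atTop m, eventually_gt_atTop 0] with n hmn hn
  exact (lintegral_mono_set (hmono hmn)).trans (h K u hu hper n hn)

end Korn

section Domain

open Set Filter

theorem setLIntegral_epigraph_eq {F : ℝ × ℝ → ENNReal} {γ : ℝ → ℝ} (hγ : Continuous γ)
    (hF : ∀ y : ℝ × ℝ, y.2 < γ y.1 → F y = 0) :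
    ∫⁻ y in {y : ℝ × ℝ | y.1 ∈ Ioo (0 : ℝ) 1 ∧ γ y.1 < y.2}, F y =
      ∫⁻ y in Ico (0 : ℝ) 1 ×ˢ univ, F y := by
  have hΩ : MeasurableSet {y : ℝ × ℝ | y.1 ∈ Ioo (0 : ℝ) 1 ∧ γ y.1 < y.2} :=
    (measurable_fst measurableSet_Ioo).inter
      (measurableSet_lt (hγ.measurable.comp measurable_fst) measurable_snd)
  have hae : ∀ᵐ y : ℝ × ℝ, y.1 ≠ 0 ∧ y.2 ≠ γ y.1 := by
    have hm : MeasurableSet {y : ℝ × ℝ | y.1 ≠ 0 ∧ y.2 ≠ γ y.1} :=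
      ((isOpen_ne_fun continuous_fst continuous_const).inter
        (isOpen_ne_fun continuous_snd (hγ.comp continuous_fst))).measurableSet
    refine (Measure.ae_prod_iff_ae_ae hm).2 ?_
    filter_upwards [Measure.ae_ne volume (0 : ℝ)] with x hx
    filter_upwards [Measure.ae_ne volume (γ x)] with t ht
    exact ⟨hx, ht⟩
  rw [← lintegral_indicator hΩ, ← lintegral_indicator (measurableSet_Ico.prod MeasurableSet.univ)]
  refine lintegral_congr_ae ?_
  filter_upwards [hae] with y hy
  by_cases h1 : y.1 ∈ Ioo (0 : ℝ) 1
  · have h2 : y ∈ Ico (0 : ℝ) 1 ×ˢ univ := ⟨Ioo_subset_Ico_self h1, trivial⟩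
    rw [indicator_of_mem h2]
    rcases lt_or_gt_of_ne hy.2 with h | h
    · rw [hF y h, indicator_apply_eq_zero.2 fun _ => hF y h]
    · exact indicator_of_mem (s := {y : ℝ × ℝ | y.1 ∈ Ioo (0 : ℝ) 1 ∧ γ y.1 < y.2}) ⟨h1, h⟩ F
  · rw [indicator_of_notMem fun h => h1 h.1, indicator_of_notMem]
    exact fun h => h1 ⟨lt_of_le_of_ne h.1.1 hy.1.symm, h.1.2⟩

end Domain

/-- Korn inequality with a Dirichlet condition at a rough bottom: there is
`C = C(p) > 0` such that for every roughness profile `γ` (continuous, 1-periodic,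
valued in `(−1,0)`) and every Lipschitz map `u`, 1-periodic in `y₁`, vanishing on
and below the rough boundary, with `p`-integrable gradient on
`Ω_bl = {0 < y₁ < 1, y₂ > γ(y₁)}`, one has `∫_{Ω_bl} ‖∇u‖_F^p ≤ C ∫_{Ω_bl} ‖Du‖_F^p`. -/
theorem korn_inequality_rough_dirichlet (p : ℝ) (hp : 1 < p) :
    ∃ C : ℝ, 0 < C ∧ ∀ (γ : ℝ → ℝ), Continuous γ → Function.Periodic γ 1 →
      (∀ t, γ t ∈ Set.Ioo (-1 : ℝ) 0) →
      ∀ (K : NNReal) (u : ℝ × ℝ → ℝ × ℝ), LipschitzWith K u →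
      (∀ y : ℝ × ℝ, u (y.1 + 1, y.2) = u y) →
      (∀ y : ℝ × ℝ, y.2 ≤ γ y.1 → u y = 0) →
      IntegrableOn (fun y => frobNorm (jacMat u y) ^ p)
        {y : ℝ × ℝ | y.1 ∈ Set.Ioo (0:ℝ) 1 ∧ γ y.1 < y.2} volume →
      (∫ y in {y : ℝ × ℝ | y.1 ∈ Set.Ioo (0:ℝ) 1 ∧ γ y.1 < y.2},
          frobNorm (jacMat u y) ^ p) ≤
        C * ∫ y in {y : ℝ × ℝ | y.1 ∈ Set.Ioo (0:ℝ) 1 ∧ γ y.1 < y.2},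
          frobNorm (symPart (jacMat u y)) ^ p := by
  obtain ⟨C, hC⟩ := exists_setLIntegral_strip_gradVec_rpow_le hp
  have hp0 : 0 < p := by linarith
  refine ⟨C + 1, by positivity, fun γ hγ _ hγ1 K u hu hper h0 hint => ?_⟩
  have hzero : ∀ y : ℝ × ℝ, y.2 < γ y.1 → fderiv ℝ u y = 0 := fun y hy => by
    have he : u =ᶠ[nhds y] fun _ => 0 := by
      filter_upwards [(isOpen_lt continuous_snd (hγ.comp continuous_fst)).mem_nhds hy] with z hz
      exact h0 z (le_of_lt hz)
    rw [he.fderiv_eq, fderiv_fun_const, Pi.zero_apply]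
  simp only [frobNorm_jacMat] at hint
  simp only [frobNorm_jacMat, frobNorm_symPart_jacMat]
  set Ω := {y : ℝ × ℝ | y.1 ∈ Set.Ioo (0:ℝ) 1 ∧ γ y.1 < y.2}
  have hints : IntegrableOn (fun y => ‖symVec (gradVec (fderiv ℝ u y))‖ ^ p) Ω :=
    Integrable.mono hint
      (((symVec.comp gradVec).continuous.norm.rpow_const fun _ => Or.inr hp0.le).measurable.comp
        (measurable_fderiv ℝ u)).aestronglyMeasurable
      (Filter.Eventually.of_forall fun y => by
        rw [Real.norm_of_nonneg (by positivity), Real.norm_of_nonneg (by positivity)]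
        exact Real.rpow_le_rpow (norm_nonneg _) (norm_symVec_le _) hp0.le)
  have hconv : ∀ Φ : (ℝ × ℝ →L[ℝ] ℝ × ℝ) →L[ℝ] EuclideanSpace ℝ (Fin 4),
      IntegrableOn (fun y => ‖Φ (fderiv ℝ u y)‖ ^ p) Ω →
      ENNReal.ofReal (∫ y in Ω, ‖Φ (fderiv ℝ u y)‖ ^ p) =
        ∫⁻ y in Set.Ico (0 : ℝ) 1 ×ˢ Set.univ, ‖Φ (fderiv ℝ u y)‖ₑ ^ p := fun Φ hΦ => by
    rw [ofReal_integral_eq_lintegral_ofReal hΦ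
      (Filter.Eventually.of_forall fun y => by positivity), ← setLIntegral_epigraph_eq hγ
      fun y hy => by rw [hzero y hy, map_zero, enorm_zero, ENNReal.zero_rpow_of_pos hp0]]
    refine lintegral_congr fun y => ?_
    rw [← ENNReal.ofReal_rpow_of_nonneg (norm_nonneg _) hp0.le, ofReal_norm]
  have hg := hconv gradVec hint
  have hs := hconv (symVec.comp gradVec) hints
  simp only [ContinuousLinearMap.comp_apply] at hs
  have h := hC K u hu hper (fun y hy => h0 y (hy.trans (hγ1 y.1).1.le))
    (hg ▸ ENNReal.ofReal_ne_top)
  have hs0 : 0 ≤ ∫ y in Ω, ‖symVec (gradVec (fderiv ℝ u y))‖ ^ p :=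
    integral_nonneg fun y => by positivity
  rw [← hg, ← hs, ← ENNReal.ofReal_coe_nnreal, ← ENNReal.ofReal_mul C.coe_nonneg,
    ENNReal.ofReal_le_ofReal_iff (by positivity)] at h
  linarith
end

section
/- (Rescaled trace inequality.) Let 1 ≤ p < ∞ and let γ : ℝ → ℝ be continuous, 1-periodic, with values in (−1, 0). There exists a constant C > 0, depending only on p and γ, such that for every positive integer N, with ε = 1/N and R^ε = {(x₁, x₂) ∈ ℝ² : 0 < x₁ < 1, ε γ(x₁/ε) < x₂ < 0}, and for every Lipschitz function φ : ℝ² → ℝ vanishing at every point (x₁, x₂) with x₂ ≤ ε γ(x₁/ε), one has ∫₀¹ |φ(x₁, 0)|^p dx₁ ≤ C ε^{p−1} ∫_{R^ε} ‖∇φ(x)‖^p dx. -/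
open MeasureTheory

/-- The Euclidean norm of the gradient of `φ : ℝ² → ℝ` (via `fderiv`, which equals
the true differential a.e. for Lipschitz functions by Rademacher's theorem). -/
noncomputable def gradNorm (φ : ℝ × ℝ → ℝ) (x : ℝ × ℝ) : ℝ :=
  Real.sqrt ((fderiv ℝ φ x (1, 0)) ^ 2 + (fderiv ℝ φ x (0, 1)) ^ 2)

/-- One-dimensional trace estimate for a Lipschitz function vanishing at the left endpoint. -/
theorem LipschitzWith.abs_rpow_le_integral_abs_deriv_rpow {p : ℝ} (hp : 1 ≤ p) {K : NNReal}
    {f : ℝ → ℝ} (hf : LipschitzWith K f) {a b : ℝ} (hab : a < b) (ha : f a = 0) :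
    |f b| ^ p ≤ (b - a) ^ (p - 1) * ∫ t in Set.Ioo a b, |deriv f t| ^ p := by
  have hp0 : 0 ≤ p := by linarith
  have hba : 0 < b - a := sub_pos.2 hab
  have hbound : ∀ t, |deriv f t| ≤ K := fun t => norm_deriv_le_of_lipschitz hf
  have hmeas : Measurable fun t => |deriv f t| := (measurable_deriv f).norm
  have hint : IntegrableOn (fun t => |deriv f t|) (Set.Ioo a b) :=
    IntegrableOn.of_bound measure_Ioo_lt_top hmeas.aestronglyMeasurable K
      (ae_of_all _ fun t => by simpa using hbound t)
  have hintp : IntegrableOn (fun t => |deriv f t| ^ p) (Set.Ioo a b) :=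
    IntegrableOn.of_bound measure_Ioo_lt_top (hmeas.pow_const p).aestronglyMeasurable (K ^ p)
      (ae_of_all _ fun t => by
        rw [Real.norm_of_nonneg (by positivity)]
        exact Real.rpow_le_rpow (abs_nonneg _) (hbound t) hp0)
  have hftc : |f b| ≤ ∫ t in Set.Ioo a b, |deriv f t| := by
    have h := (hf.lipschitzOnWith (s := Set.uIcc a b)).absolutelyContinuousOnInterval
      |>.integral_deriv_eq_sub
    rw [intervalIntegral.integral_of_le hab.le, integral_Ioc_eq_integral_Ioo, ha, sub_zero] at h
    rw [← h]
    exact abs_integral_le_integral_abs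
  have hjensen := (convexOn_rpow hp).map_set_average_le (μ := volume) (t := Set.Ioo a b)
    (f := fun t => |deriv f t|) (continuousOn_id.rpow_const fun _ _ => Or.inr hp0) isClosed_Ici
    (by simp [hab]) (by simp) (ae_of_all _ fun t => Set.mem_Ici.2 (abs_nonneg _)) hint hintp
  simp only [setAverage_eq, smul_eq_mul, Real.volume_real_Ioo_of_le hab.le] at hjensen
  rw [Real.mul_rpow (by positivity) (by positivity), Real.inv_rpow hba.le] at hjensen
  refine (Real.rpow_le_rpow (abs_nonneg _) hftc hp0).trans ?_
  rw [Real.rpow_sub_one hba.ne']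
  have hpos : 0 < (b - a) ^ p := by positivity
  rw [inv_mul_le_iff₀ hpos] at hjensen
  exact hjensen.trans_eq (by ring)

theorem gradNorm_nonneg (φ : ℝ × ℝ → ℝ) (x : ℝ × ℝ) : 0 ≤ gradNorm φ x :=
  Real.sqrt_nonneg _

theorem measurable_gradNorm (φ : ℝ × ℝ → ℝ) : Measurable (gradNorm φ) :=
  (((measurable_fderiv_apply_const ℝ φ (1, 0)).pow_const 2).add
    ((measurable_fderiv_apply_const ℝ φ (0, 1)).pow_const 2)).sqrt

theorem LipschitzWith.gradNorm_le {K : NNReal} {φ : ℝ × ℝ → ℝ} (hφ : LipschitzWith K φ)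
    (x : ℝ × ℝ) : gradNorm φ x ≤ 2 * K := by
  have h (v : ℝ × ℝ) (hv : ‖v‖ ≤ 1) : (fderiv ℝ φ x v) ^ 2 ≤ (K : ℝ) ^ 2 := by
    refine sq_le_sq.2 (le_trans ?_ (le_abs_self _))
    have := (fderiv ℝ φ x).le_of_opNorm_le (norm_fderiv_le_of_lipschitz ℝ hφ) v
    exact this.trans (mul_le_of_le_one_right K.2 hv)
  have h₁ := h (1, 0) (by simp [Prod.norm_def])
  have h₂ := h (0, 1) (by simp [Prod.norm_def])
  refine Real.sqrt_le_iff.2 ⟨by positivity, ?_⟩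
  nlinarith [sq_nonneg (K : ℝ)]

theorem abs_deriv_le_gradNorm {φ : ℝ × ℝ → ℝ} {s t : ℝ}
    (h : DifferentiableAt ℝ φ (s, t)) :
    |deriv (fun u => φ (s, u)) t| ≤ gradNorm φ (s, t) := by
  have hd : HasDerivAt (fun u : ℝ => (s, u)) ((0 : ℝ), (1 : ℝ)) t :=
    (hasDerivAt_const t s).prodMk (hasDerivAt_id t)
  have hd' : HasDerivAt (fun u => φ (s, u)) (fderiv ℝ φ (s, t) (0, 1)) t :=
    h.hasFDerivAt.comp_hasDerivAt t hd
  rw [hd'.deriv]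
  exact Real.abs_le_sqrt (le_add_of_nonneg_left (sq_nonneg _))

/-- Rescaled trace inequality: with `ε = 1/N` and the rough layer
`R^ε = {0 < x₁ < 1, ε γ(x₁/ε) < x₂ < 0}`, every Lipschitz `φ` vanishing on and
below the rough boundary satisfies
`∫₀¹ |φ(x₁,0)|^p dx₁ ≤ C ε^{p−1} ∫_{R^ε} ‖∇φ‖^p`, with `C = C(p, γ)`. -/
theorem rescaled_trace_inequality (p : ℝ) (hp : 1 ≤ p) (γ : ℝ → ℝ)
    (hγc : Continuous γ) (hγper : Function.Periodic γ 1)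
    (hγval : ∀ t, γ t ∈ Set.Ioo (-1 : ℝ) 0) :
    ∃ C : ℝ, 0 < C ∧ ∀ N : ℕ, 0 < N →
      ∀ (K : NNReal) (φ : ℝ × ℝ → ℝ), LipschitzWith K φ →
      (∀ x : ℝ × ℝ, x.2 ≤ (1 / N : ℝ) * γ (x.1 / (1 / N : ℝ)) → φ x = 0) →
      (∫ x₁ in Set.Ioo (0:ℝ) 1, |φ (x₁, 0)| ^ p) ≤
        C * (1 / N : ℝ) ^ (p - 1) *
          ∫ x in {x : ℝ × ℝ | x.1 ∈ Set.Ioo (0:ℝ) 1 ∧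
              (1 / N : ℝ) * γ (x.1 / (1 / N : ℝ)) < x.2 ∧ x.2 < 0},
            gradNorm φ x ^ p := by
  have hp0 : 0 ≤ p := by linarith
  refine ⟨1, one_pos, fun N hN K φ hφ hzero => ?_⟩
  have hε : (0 : ℝ) < 1 / N := by positivity
  have hε1 : (1 : ℝ) / N ≤ 1 := by
    rw [div_le_one (by positivity)]
    exact_mod_cast hN
  generalize (1 / N : ℝ) = ε at *
  set g : ℝ → ℝ := fun s => ε * γ (s / ε) with hg
  have hgc : Continuous g := by fun_prop
  have hg0 (s : ℝ) : g s < 0 := mul_neg_of_pos_of_neg hε (hγval _).2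
  have hgε (s : ℝ) : -ε < g s := by
    have := mul_lt_mul_of_pos_left (hγval (s / ε)).1 hε
    simp only [hg]
    linarith
  set S : Set (ℝ × ℝ) := {x | x.1 ∈ Set.Ioo (0 : ℝ) 1 ∧ g x.1 < x.2 ∧ x.2 < 0}
  have hSmeas : MeasurableSet S :=
    (measurable_fst measurableSet_Ioo).inter
      ((measurableSet_lt (hgc.measurable.comp measurable_fst) measurable_snd).inter
        (measurableSet_lt measurable_snd measurable_const))
  have hSfin : volume S < ⊤ := by
    refine ((Metric.isBounded_Ioo (0 : ℝ) 1).prod (Metric.isBounded_Ioo (-1 : ℝ) 0)).subset ?_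
      |>.measure_lt_top
    rintro x ⟨h1, h2, h3⟩
    exact ⟨h1, by linarith [hgε x.1], h3⟩
  set G : ℝ × ℝ → ℝ := S.indicator fun x => gradNorm φ x ^ p with hG
  have hG0 (x : ℝ × ℝ) : 0 ≤ G x :=
    Set.indicator_nonneg (fun x _ => Real.rpow_nonneg (gradNorm_nonneg φ x) p) x
  have hGint : Integrable G (volume.prod volume) := by
    refine (integrable_indicator_iff hSmeas).2 (IntegrableOn.of_bound hSfin
      ((measurable_gradNorm φ).pow_const p).aestronglyMeasurable ((2 * K) ^ p)
      (ae_of_all _ fun x => ?_))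
    rw [Real.norm_of_nonneg (Real.rpow_nonneg (gradNorm_nonneg φ x) p)]
    exact Real.rpow_le_rpow (gradNorm_nonneg φ x) (hφ.gradNorm_le x) hp0
  have hslice : ∀ᵐ s, s ∈ Set.Ioo (0 : ℝ) 1 →
      |φ (s, 0)| ^ p ≤ ε ^ (p - 1) * ∫ t, G (s, t) := by
    have hdiff : ∀ᵐ x ∂((volume : Measure ℝ).prod (volume : Measure ℝ)),
        DifferentiableAt ℝ φ x := hφ.ae_differentiableAt
    filter_upwards [Measure.ae_ae_of_ae_prod hdiff, hGint.prod_right_ae] with s hds hGs hs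
    have hφs : LipschitzWith K fun t => φ (s, t) := by
      simpa using! hφ.comp (LipschitzWith.prodMk_left s)
    refine (hφs.abs_rpow_le_integral_abs_deriv_rpow hp (hg0 s) (hzero _ le_rfl)).trans ?_
    refine mul_le_mul (Real.rpow_le_rpow (by linarith [hg0 s]) (by linarith [hgε s])
      (by linarith)) ?_ (by positivity) (by positivity)
    rw [← integral_indicator measurableSet_Ioo]
    refine integral_mono_of_nonneg
      (ae_of_all _ fun t => Set.indicator_nonneg (fun t _ => by positivity) t) hGs ?_
    filter_upwards [hds] with t ht
    by_cases hts : t ∈ Set.Ioo (g s) 0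
    · have hmem : (s, t) ∈ S := ⟨hs, hts⟩
      simp only [hG, Set.indicator_of_mem hts, Set.indicator_of_mem hmem]
      exact Real.rpow_le_rpow (abs_nonneg _) (abs_deriv_le_gradNorm ht) hp0
    · rw [Set.indicator_of_notMem hts]
      exact hG0 _
  have hlhs : IntegrableOn (fun s => |φ (s, 0)| ^ p) (Set.Ioo 0 1) := by
    have hc : Continuous fun s => |φ (s, 0)| ^ p :=
      (hφ.continuous.comp (by fun_prop)).abs.rpow_const fun _ => Or.inr hp0
    exact (hc.integrableOn_Icc (a := 0) (b := 1)).mono_set Set.Ioo_subset_Icc_self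
  have hGleft : Integrable fun s => ∫ t, G (s, t) := hGint.integral_prod_left
  calc ∫ s in Set.Ioo (0 : ℝ) 1, |φ (s, 0)| ^ p
      ≤ ∫ s in Set.Ioo (0 : ℝ) 1, ε ^ (p - 1) * ∫ t, G (s, t) :=
        setIntegral_mono_on_ae hlhs (hGleft.const_mul _).integrableOn measurableSet_Ioo hslice
    _ ≤ ∫ s, ε ^ (p - 1) * ∫ t, G (s, t) :=
        setIntegral_le_integral (hGleft.const_mul _) (ae_of_all _ fun s =>
          mul_nonneg (by positivity) (integral_nonneg fun t => hG0 (s, t)))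
    _ = 1 * ε ^ (p - 1) * ∫ x in S, gradNorm φ x ^ p := by
        rw [integral_const_mul, ← integral_prod G hGint, one_mul, hG, ← Measure.volume_eq_prod,
          integral_indicator hSmeas]
end

section
/- (Rigid motions in two dimensions.) Let Ω ⊆ ℝ² be open and connected, and let u : Ω → ℝ² be continuously differentiable with Du(y) = 0 for every y ∈ Ω, where Du(y) = (∇u(y) + ∇u(y)ᵀ)/2 denotes the symmetric part of the Jacobian matrix ∇u(y). Then there exist a constant vector c ∈ ℝ² and a scalar λ ∈ ℝ such that u(y₁, y₂) = c + λ (−y₂, y₁) for all (y₁, y₂) ∈ Ω. -/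
open Matrix

/-- On an open convex set where the derivative of `f` in the direction `w` vanishes,
`f` is invariant under translation by `w`. -/
theorem apply_add_eq_of_fderiv_apply_eq_zero {E : Type*} [NormedAddCommGroup E] [NormedSpace ℝ E]
    {U : Set E} (hUo : IsOpen U) (hUc : Convex ℝ U) {f : E → ℝ} (hf : DifferentiableOn ℝ f U)
    {w : E} (hw : ∀ z ∈ U, fderiv ℝ f z w = 0) {p : E} (hp : p ∈ U) (hpw : p + w ∈ U) :
    f (p + w) = f p := by
  obtain ⟨z, hz, h⟩ := domain_mvt
    (fun x hx => ((hf x hx).differentiableAt (hUo.mem_nhds hx)).hasFDerivAt.hasFDerivWithinAt)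
    hUc hp hpw
  rw [add_sub_cancel_left, hw z (hUc.segment_subset hp hpw hz)] at h
  exact sub_eq_zero.mp h

/-- On an open convex set where the derivative of `f` in the direction `w` vanishes,
the derivative of `f` is invariant under translation by `w`. -/
theorem fderiv_add_eq_of_fderiv_apply_eq_zero {E : Type*} [NormedAddCommGroup E] [NormedSpace ℝ E]
    {U : Set E} (hUo : IsOpen U) (hUc : Convex ℝ U) {f : E → ℝ} (hf : DifferentiableOn ℝ f U)
    {w : E} (hw : ∀ z ∈ U, fderiv ℝ f z w = 0) {p : E} (hp : p ∈ U) (hpw : p + w ∈ U) :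
    fderiv ℝ f (p + w) = fderiv ℝ f p := by
  rw [← fderiv_comp_add_right]
  apply Filter.EventuallyEq.fderiv_eq
  filter_upwards [hUo.mem_nhds hp,
    (continuous_add_const w).continuousAt.preimage_mem_nhds (hUo.mem_nhds hpw)] with x hx hxw
  exact apply_add_eq_of_fderiv_apply_eq_zero hUo hUc hf hw hx hxw

/-- The partial derivatives of the components of a map with vanishing symmetric gradient. -/
theorem symPart_jacMat_eq_zero {u : ℝ × ℝ → ℝ × ℝ} {y : ℝ × ℝ} (h : symPart (jacMat u y) = 0) :
    (fderiv ℝ u y (1, 0)).1 = 0 ∧ (fderiv ℝ u y (0, 1)).2 = 0 ∧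
      (fderiv ℝ u y (0, 1)).1 = -(fderiv ℝ u y (1, 0)).2 := by
  have h00 := congrFun (congrFun h 0) 0
  have h01 := congrFun (congrFun h 0) 1
  have h11 := congrFun (congrFun h 1) 1
  simp [symPart, jacMat] at h00 h01 h11
  refine ⟨by linarith, by linarith, by linarith⟩

/-- The rotation rate of a map with vanishing symmetric gradient is constant on balls. -/
theorem fderiv_snd_eq_of_mem_ball {u : ℝ × ℝ → ℝ × ℝ} {x y : ℝ × ℝ} {r : ℝ}
    (hu : ∀ z ∈ Metric.ball x r, DifferentiableAt ℝ u z)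
    (hD : ∀ z ∈ Metric.ball x r, symPart (jacMat u z) = 0) (hy : y ∈ Metric.ball x r) :
    (fderiv ℝ u y (1, 0)).2 = (fderiv ℝ u x (1, 0)).2 := by
  have hfst : ∀ z ∈ Metric.ball x r, ∀ v,
      fderiv ℝ (fun p => (u p).1) z v = (fderiv ℝ u z v).1 := fun z hz v => by
    rw [(hu z hz).hasFDerivAt.fst.fderiv]; rfl
  have hsnd : ∀ z ∈ Metric.ball x r, ∀ v,
      fderiv ℝ (fun p => (u p).2) z v = (fderiv ℝ u z v).2 := fun z hz v => by
    rw [(hu z hz).hasFDerivAt.snd.fderiv]; rfl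
  have hdfst : DifferentiableOn ℝ (fun p => (u p).1) (Metric.ball x r) :=
    fun z hz => (hu z hz).fst.differentiableWithinAt
  have hdsnd : DifferentiableOn ℝ (fun p => (u p).2) (Metric.ball x r) :=
    fun z hz => (hu z hz).snd.differentiableWithinAt
  have hx : x ∈ Metric.ball x r := Metric.mem_ball_self (dist_nonneg.trans_lt hy)
  have hcorner : (y.1, x.2) ∈ Metric.ball x r := by
    rw [Metric.mem_ball, Prod.dist_eq] at hy ⊢
    simpa [dist_nonneg] using (le_max_left _ _).trans_lt hy
  have hhor : x + (y.1 - x.1) • ((1, 0) : ℝ × ℝ) = (y.1, x.2) := by ext <;> simp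
  have hver : (y.1, x.2) + (y.2 - x.2) • ((0, 1) : ℝ × ℝ) = y := by ext <;> simp
  have h₁ := fderiv_add_eq_of_fderiv_apply_eq_zero Metric.isOpen_ball (convex_ball x r) hdfst
    (w := (y.1 - x.1) • ((1, 0) : ℝ × ℝ))
    (fun z hz => by rw [map_smul, hfst z hz, (symPart_jacMat_eq_zero (hD z hz)).1, smul_zero])
    hx (hhor ▸ hcorner)
  have h₂ := fderiv_add_eq_of_fderiv_apply_eq_zero Metric.isOpen_ball (convex_ball x r) hdsnd
    (w := (y.2 - x.2) • ((0, 1) : ℝ × ℝ))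
    (fun z hz => by rw [map_smul, hsnd z hz, (symPart_jacMat_eq_zero (hD z hz)).2.1, smul_zero])
    hcorner (by rwa [hver])
  rw [hhor] at h₁
  rw [hver] at h₂
  have e₁ := DFunLike.congr_fun h₁ ((0, 1) : ℝ × ℝ)
  have e₂ := DFunLike.congr_fun h₂ ((1, 0) : ℝ × ℝ)
  rw [hfst _ hcorner, hfst _ hx, (symPart_jacMat_eq_zero (hD _ hcorner)).2.2,
    (symPart_jacMat_eq_zero (hD _ hx)).2.2] at e₁
  rw [hsnd _ hy, hsnd _ hcorner] at e₂
  linarith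

/-- Rigid motions in two dimensions: if `u` is `C¹` on an open connected `Ω ⊆ ℝ²`
with vanishing symmetric gradient, then `u(y) = c + λ(−y₂, y₁)` on `Ω`. -/
theorem rigid_motion_of_symmetric_gradient_eq_zero
    (Ω : Set (ℝ × ℝ)) (hΩopen : IsOpen Ω) (hΩconn : IsConnected Ω)
    (u : ℝ × ℝ → ℝ × ℝ) (hu : ContDiffOn ℝ 1 u Ω)
    (hD : ∀ y ∈ Ω, symPart (jacMat u y) = 0) :
    ∃ (c : ℝ × ℝ) (l : ℝ), ∀ y ∈ Ω, u y = (c.1 - l * y.2, c.2 + l * y.1) := by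
  have hdiff : ∀ z ∈ Ω, DifferentiableAt ℝ u z := fun z hz =>
    (hu.differentiableOn one_ne_zero z hz).differentiableAt (hΩopen.mem_nhds hz)
  have hloc : ∀ x ∈ Ω, (fun y => (fderiv ℝ u y (1, 0)).2) =ᶠ[nhds x]
      fun _ => (fderiv ℝ u x (1, 0)).2 := by
    intro x hx
    obtain ⟨r, hr, hball⟩ := Metric.isOpen_iff.mp hΩopen x hx
    filter_upwards [Metric.ball_mem_nhds x hr] with y hy
    exact fderiv_snd_eq_of_mem_ball (fun z hz => hdiff z (hball hz))
      (fun z hz => hD z (hball hz)) hy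
  obtain ⟨l, hl⟩ := hΩopen.exists_is_const_of_fderiv_eq_zero
    (f := fun y => (fderiv ℝ u y (1, 0)).2) (𝕜 := ℝ) hΩconn.isPreconnected
    (fun x hx => ((hloc x hx).differentiableAt_iff.mpr
      (differentiableAt_const _)).differentiableWithinAt)
    (fun x hx => by rw [(hloc x hx).fderiv_eq]; simp)
  let R : ℝ × ℝ →L[ℝ] ℝ × ℝ :=
    (-(l • ContinuousLinearMap.snd ℝ ℝ ℝ)).prod (l • ContinuousLinearMap.fst ℝ ℝ ℝ)
  have hR : ∀ x ∈ Ω, fderiv ℝ u x = R := by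
    intro x hx
    obtain ⟨h1, h2, h3⟩ := symPart_jacMat_eq_zero (hD x hx)
    have h4 := hl x hx
    ext <;> simp_all [R]
  obtain ⟨c, hc⟩ := hΩopen.exists_is_const_of_fderiv_eq_zero (𝕜 := ℝ)
    (f := fun y => u y - R y)
    hΩconn.isPreconnected
    (fun x hx => ((hdiff x hx).sub R.differentiableAt).differentiableWithinAt)
    (fun x hx => by
      rw [fderiv_fun_sub (hdiff x hx) R.differentiableAt, R.fderiv, hR x hx, sub_self]; rfl)
  refine ⟨c, l, fun y hy => ?_⟩
  rw [← sub_add_cancel (u y) (R y), hc y hy]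
  ext <;> simp [R, sub_eq_add_neg]
end
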